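/- arXiv:1708.07927 — 7 statements merged into one kernel-verified Lean document; each statement's English description precedes it below -/
import Mathlib

section
/- Let X be an infinite Tychonoff space and λ a cardinal. Assume that some finite power X^n (n ≥ 1) has a discrete subspace of cardinality λ. Let {⟨A_α, B_α⟩ : α < λ} be a family of pairs of disjoint functionally closed subsets of X. Then there exists a discrete subspace F of C_p^2(X) with the following property: whenever a ∈ A_α and b ∈ B_α for some α < λ, there is ⟨f, g⟩ ∈ F with f(a) ≠ f(b) or g(a) ≠ g(b). -/
open Cardinal Set

universe u

/-- `C_p(X)`: continuous real-valued functions with the topology of pointwise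
convergence (subspace of the product `X → ℝ`). -/
def Cp (X : Type u) [TopologicalSpace X] : Type u := {f : X → ℝ // Continuous f}

instance (X : Type u) [TopologicalSpace X] : TopologicalSpace (Cp X) :=
  inferInstanceAs (TopologicalSpace {f : X → ℝ // Continuous f})

/-- The spread of a space: the supremum of cardinalities of its discrete subspaces. -/
noncomputable def spread (Y : Type u) [TopologicalSpace Y] : Cardinal.{u} :=
  ⨆ D : {D : Set Y // DiscreteTopology ↥D}, #↥D.1

/-- The weight of a space: the least cardinality of a topological basis. -/
noncomputable def weight (X : Type u) [TopologicalSpace X] : Cardinal.{u} :=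
  ⨅ B : {B : Set (Set X) // TopologicalSpace.IsTopologicalBasis B}, #↥B.1

/-- The i-weight of a space: the least weight of a coarser Tychonoff topology on the
same underlying set. -/
noncomputable def iweight (X : Type u) [t : TopologicalSpace X] : Cardinal.{u} :=
  ⨅ t' : {t' : TopologicalSpace X // t ≤ t' ∧ @T35Space X t'}, @weight X t'.1

/-- The σ-product of `X^ω` with basepoint `b`: all points of the countable power
differing from `b` in at most finitely many coordinates. -/
def sigmaProd (X : Type u) [TopologicalSpace X] (b : ℕ → X) : Set (ℕ → X) :=
  {y | {n | y n ≠ b n}.Finite}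

/-- A set of pairs of continuous functions separates points of `X`. -/
def PointSep2 {X : Type u} [TopologicalSpace X] (F : Set (Cp X × Cp X)) : Prop :=
  ∀ x y : X, x ≠ y → ∃ p ∈ F, p.1.1 x ≠ p.1.1 y ∨ p.2.1 x ≠ p.2.1 y

/-- A set of continuous functions separates points of `X`. -/
def PointSep1 {X : Type u} [TopologicalSpace X] (F : Set (Cp X)) : Prop :=
  ∀ x y : X, x ≠ y → ∃ f ∈ F, f.1 x ≠ f.1 y

/-- A point-separating set in `C_p^m(X)`. -/
def PointSepM {X : Type u} [TopologicalSpace X] {m : ℕ} (F : Set (Fin m → Cp X)) : Prop :=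
  ∀ x y : X, x ≠ y → ∃ f ∈ F, ∃ i, (f i).1 x ≠ (f i).1 y

/-- A functionally closed set (zero-set). -/
def FunctionallyClosed {X : Type u} [TopologicalSpace X] (A : Set X) : Prop :=
  ∃ g : X → ℝ, Continuous g ∧ A = g ⁻¹' {0}

/-- Zero-dimensionality in the sense of covering dimension (`dim X = 0`): any two disjoint
functionally closed sets are separated by a clopen set. -/
def ZeroDimensional (X : Type u) [TopologicalSpace X] : Prop :=
  ∀ A B : Set X, FunctionallyClosed A → FunctionallyClosed B → Disjoint A B →
    ∃ U : Set X, IsClopen U ∧ A ⊆ U ∧ Disjoint U B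

/-- Choosing a cut value of a separating function away from finitely many points. -/
lemma exists_cut {X : Type u} [TopologicalSpace X] (S : Finset X) (A B : Set X)
    (hA : FunctionallyClosed A) (hB : FunctionallyClosed B) (hAB : Disjoint A B) :
    ∃ q : X → ℝ, Continuous q ∧ (∀ x ∈ S, 1 < q x ∨ q x < -1) ∧ (∀ a ∈ A, 1 ≤ q a) ∧
      (∀ b ∈ B, q b ≤ -1) := by
  obtain ⟨g₁, hg₁, rfl⟩ := hA
  obtain ⟨g₂, hg₂, rfl⟩ := hB
  have hpos : ∀ x, 0 < |g₁ x| + |g₂ x| := by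
    intro x
    by_contra hx
    have h1 := abs_nonneg (g₁ x)
    have h2 := abs_nonneg (g₂ x)
    have e1 : g₁ x = 0 := abs_eq_zero.1 (by linarith)
    have e2 : g₂ x = 0 := abs_eq_zero.1 (by linarith)
    exact Set.disjoint_left.1 hAB (show x ∈ g₁ ⁻¹' {0} from e1) e2
  let h : X → ℝ := fun x => |g₁ x| / (|g₁ x| + |g₂ x|)
  have hh : Continuous h := hg₁.abs.div (hg₁.abs.add hg₂.abs) (fun x => (hpos x).ne')
  obtain ⟨t, ht, htS⟩ : ∃ t ∈ Set.Ioo (0:ℝ) 1, t ∉ (h '' (S : Set X)) :=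
    ((Set.Ioo_infinite (zero_lt_one (α := ℝ))).exists_notMem_finite
      (S.finite_toSet.image h))
  obtain ⟨δ, hδ, hδt, hδt', hδS⟩ : ∃ δ : ℝ, 0 < δ ∧ δ ≤ t ∧ δ ≤ 1 - t ∧
      ∀ x ∈ S, δ < |t - h x| := by
    have key : ∀ T : Finset X, T ⊆ S → ∃ δ : ℝ, 0 < δ ∧ δ ≤ t ∧ δ ≤ 1 - t ∧
      ∀ x ∈ T, δ < |t - h x| := by
      classical
      intro T
      induction T using Finset.induction_on with
      | empty =>
        intro _
        exact ⟨min t (1 - t), lt_min ht.1 (by linarith [ht.2]), min_le_left _ _,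
          min_le_right _ _, by simp⟩
      | insert x T _ ih =>
        intro hT
        obtain ⟨δ, h0, h1, h2, h3⟩ := ih (fun y hy => hT (Finset.mem_insert_of_mem hy))
        have hx : 0 < |t - h x| := by
          apply abs_pos.2
          intro h0
          exact htS ⟨x, hT (Finset.mem_insert_self _ _), by linarith⟩
        refine ⟨min δ (|t - h x| / 2), lt_min h0 (by linarith), (min_le_left _ _).trans h1,
          (min_le_left _ _).trans h2, ?_⟩
        intro y hy
        rcases Finset.mem_insert.1 hy with rfl | hy
        · exact (min_le_right _ _).trans_lt (by linarith)
        · exact (min_le_left _ _).trans_lt (h3 y hy)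
    exact key S (Finset.Subset.refl S)
  refine ⟨fun x => (t - h x) / δ, (continuous_const.sub hh).div_const δ, ?_, ?_, ?_⟩
  · intro x hx
    rcases lt_abs.1 (hδS x hx) with h1 | h1
    · left
      rw [one_lt_div hδ]; exact h1
    · right
      rw [div_lt_iff₀ hδ]; linarith
  · intro a ha
    have ha : g₁ a = 0 := ha
    have : h a = 0 := by simp [h, ha]
    simp only [this]
    rw [one_le_div hδ]; linarith
  · intro b hb
    have hb : g₂ b = 0 := hb
    have : h b = 1 := by
      have := hpos b
      simp only [h, hb, abs_zero, add_zero] at this ⊢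
      exact div_self this.ne'
    simp only [this]
    rw [div_le_iff₀ hδ]; linarith

/-- The pair of functions attached to one pair of zero-sets and one finite set of points. -/
lemma exists_pair {X : Type u} [TopologicalSpace X] [T35Space X] (S : Finset X) (A B : Set X)
    (hA : FunctionallyClosed A) (hB : FunctionallyClosed B) (hAB : Disjoint A B)
    (M : ℕ) (v : X → ℕ) (hv1 : ∀ x ∈ S, 1 ≤ v x) (hvM : ∀ x ∈ S, v x ≤ M)
    (hinj : Set.InjOn v (S : Set X)) (W : X → Set X)
    (hW : ∀ x ∈ S, IsOpen (W x) ∧ x ∈ W x) :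
    ∃ f g : X → ℝ, Continuous f ∧ Continuous g ∧ (∀ x ∈ S, f x = v x ∧ g x = 0) ∧
      (∀ y, ∀ m : ℕ, 1 ≤ m → |f y - m| < 1 / 2 → |g y| < 1 / (2 * (M + 1)) →
        ∃ x ∈ S, v x = m ∧ y ∈ W x) ∧
      (∀ a ∈ A, ∀ b ∈ B, f a ≠ f b ∨ g a ≠ g b) := by
  classical
  obtain ⟨q, hq, hqS, hqA, hqB⟩ := exists_cut S A B hA hB hAB
  let s : X → ℝ := fun x => max (-1) (min 1 (q x))
  have hs : Continuous s := continuous_const.max (continuous_const.min hq)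
  have hs1 : ∀ x, 1 ≤ q x → s x = 1 := by
    intro x hx
    simp [s, min_eq_left hx]
  have hs2 : ∀ x, q x ≤ -1 → s x = -1 := by
    intro x hx
    have : min 1 (q x) ≤ -1 := (min_le_right _ _).trans hx
    simp only [s]; exact max_eq_left this
  obtain ⟨V, hV, hVd⟩ := S.finite_toSet.t2_separation
  let N : X → Set X := fun x => if 1 < q x then {y | 1 < q y} else {y | q y < -1}
  have hN : ∀ x, IsOpen (N x) := by
    intro x
    simp only [N]
    split_ifs
    · exact isOpen_lt continuous_const hq
    · exact isOpen_lt hq continuous_const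
  have hNx : ∀ x ∈ S, x ∈ N x := by
    intro x hx
    simp only [N]
    split_ifs with h
    · exact h
    · exact (hqS x hx).resolve_left h
  have hNs : ∀ x, (∀ y ∈ N x, s y = 1) ∨ (∀ y ∈ N x, s y = -1) := by
    intro x
    by_cases h : 1 < q x
    · left; intro y hy
      simp only [N, if_pos h] at hy
      exact hs1 y (le_of_lt hy)
    · right; intro y hy
      simp only [N, if_neg h] at hy
      exact hs2 y (le_of_lt hy)
  have hbump : ∀ x ∈ S, ∃ b : X → ℝ, Continuous b ∧ b x = 1 ∧ (∀ y, 0 ≤ b y ∧ b y ≤ 1) ∧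
      ∀ y, y ∉ W x ∩ V x ∩ N x → b y = 0 := by
    intro x hx
    have ho : IsOpen (W x ∩ V x ∩ N x) := ((hW x hx).1.inter (hV x).2).inter (hN x)
    obtain ⟨u, hu, hux, huK⟩ := CompletelyRegularSpace.completely_regular x
      (W x ∩ V x ∩ N x)ᶜ ho.isClosed_compl
      (fun h => h ⟨⟨(hW x hx).2, (hV x).1⟩, hNx x hx⟩)
    refine ⟨fun y => 1 - (u y : ℝ), continuous_const.sub (continuous_subtype_val.comp hu),
      by simp [hux], fun y => ⟨by linarith [(u y).2.2], by linarith [(u y).2.1]⟩, ?_⟩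
    intro y hy
    have := huK hy
    simp [this]
  choose! b hbc hbx hb01 hb0 using hbump
  let f : X → ℝ := fun y => ∑ x ∈ S, (v x : ℝ) * b x y
  let g : X → ℝ := fun y => s y * (1 - ∑ x ∈ S, b x y)
  have hf : Continuous f :=
    continuous_finsetSum S (fun x hx => continuous_const.mul (hbc x hx))
  have hg : Continuous g :=
    hs.mul (continuous_const.sub (continuous_finsetSum S (fun x hx => hbc x hx)))
  have hin : ∀ x ∈ S, ∀ y ∈ W x ∩ V x ∩ N x, f y = v x * b x y ∧ g y = s y * (1 - b x y) := by
    intro x hx y hy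
    have h0 : ∀ z ∈ S, z ≠ x → b z y = 0 := by
      intro z hz hzx
      apply hb0 z hz
      intro hy'
      exact Set.disjoint_left.1 (hVd hz hx hzx) hy'.1.2 hy.1.2
    constructor
    · exact Finset.sum_eq_single_of_mem x hx (fun z hz hzx => by rw [h0 z hz hzx, mul_zero])
    · simp only [g]
      rw [Finset.sum_eq_single_of_mem x hx h0]
  have hdich : ∀ y, (f y = 0 ∧ g y = s y) ∨ ∃ x ∈ S, y ∈ W x ∩ V x ∩ N x := by
    intro y
    by_cases h : ∃ x ∈ S, y ∈ W x ∩ V x ∩ N x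
    · exact Or.inr h
    · left
      push Not at h
      have h0 : ∀ x ∈ S, b x y = 0 := fun x hx => hb0 x hx y (h x hx)
      constructor
      · exact Finset.sum_eq_zero (fun x hx => by rw [h0 x hx, mul_zero])
      · simp only [g]
        rw [Finset.sum_eq_zero h0]; ring
  refine ⟨f, g, hf, hg, ?_, ?_, ?_⟩
  · intro x hx
    obtain ⟨h1, h2⟩ := hin x hx x ⟨⟨(hW x hx).2, (hV x).1⟩, hNx x hx⟩
    rw [hbx x hx] at h1 h2
    exact ⟨by rw [h1]; ring, by rw [h2]; ring⟩
  · intro y m hm hfm hgm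
    rcases hdich y with ⟨h1, -⟩ | ⟨x, hx, hy⟩
    · rw [h1] at hfm
      have : (1:ℝ) ≤ m := by exact_mod_cast hm
      have := (abs_lt.1 hfm).1
      linarith
    · refine ⟨x, hx, ?_, hy.1.1⟩
      obtain ⟨h1, h2⟩ := hin x hx y hy
      have hab : |g y| = 1 - b x y := by
        rw [h2, abs_mul]
        have : |s y| = 1 := by
          rcases hNs x with h | h <;> rw [h y hy.2] <;> simp
        rw [this, one_mul, abs_of_nonneg]
        linarith [(hb01 x hx y).2]
      rw [hab] at hgm
      rw [h1] at hfm
      have hM : (v x : ℝ) ≤ M := by exact_mod_cast hvM x hx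
      have hM0 : (0:ℝ) ≤ v x := Nat.cast_nonneg _
      have e1 : (v x : ℝ) * (1 - b x y) ≤ 1 / 2 := by
        have hMp : (0:ℝ) < 2 * (M + 1) := by positivity
        rw [lt_div_iff₀ hMp] at hgm
        have := (hb01 x hx y).2
        nlinarith
      have e2 : 0 ≤ (v x : ℝ) * (1 - b x y) :=
        mul_nonneg hM0 (by linarith [(hb01 x hx y).2])
      obtain ⟨e3, e4⟩ := abs_lt.1 hfm
      have l1 : (v x : ℝ) < m + 1 := by linarith
      have l2 : (m : ℝ) < v x + 1 := by linarith
      have l1' : v x < m + 1 := by exact_mod_cast l1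
      have l2' : m < v x + 1 := by exact_mod_cast l2
      omega
  · intro a ha c hc
    by_contra hcon
    push Not at hcon
    obtain ⟨hfe, hge⟩ := hcon
    have sa : s a = 1 := hs1 a (hqA a ha)
    have sc : s c = -1 := hs2 c (hqB c hc)
    rcases hdich a with ⟨h1, h2⟩ | ⟨x, hx, hy⟩
    · rcases hdich c with ⟨k1, k2⟩ | ⟨z, hz, hy'⟩
      · linarith
      · obtain ⟨k1, k2⟩ := hin z hz c hy'
        rw [sc] at k2
        linarith [(hb01 z hz c).2]
    · obtain ⟨h1, h2⟩ := hin x hx a hy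
      rw [sa] at h2
      rcases hdich c with ⟨k1, k2⟩ | ⟨z, hz, hy'⟩
      · linarith [(hb01 x hx a).2]
      · obtain ⟨k1, k2⟩ := hin z hz c hy'
        rw [sc] at k2
        have b1 := (hb01 x hx a).2
        have b2 := (hb01 z hz c).2
        have e1 : b x a = 1 := by linarith
        have e2 : b z c = 1 := by linarith
        rw [e1] at h1
        rw [e2] at k1
        have : (v x : ℝ) = v z := by linarith
        have hvz : v x = v z := by exact_mod_cast this
        have hxz : x = z := hinj hx hz hvz
        subst hxz
        rcases hNs x with h | h
        · have := h c hy'.2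
          linarith
        · have := h a hy.2
          linarith

/-- If some finite power of `X` has a discrete subspace of size `λ`, then for every
`λ`-indexed family of pairs of disjoint functionally closed subsets of `X` there is a
discrete subspace `F` of `C_p^2(X)` separating each pair. -/
theorem stmt11 {X : Type u} [TopologicalSpace X] [T35Space X] [Infinite X]
    (lam : Cardinal.{u})
    (hD : ∃ n : ℕ, 1 ≤ n ∧ ∃ D : Set (Fin n → X), DiscreteTopology ↥D ∧ #↥D = lam)
    (ι : Type u) (hι : #ι = lam) (A B : ι → Set X)
    (hA : ∀ i, FunctionallyClosed (A i)) (hB : ∀ i, FunctionallyClosed (B i))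
    (hAB : ∀ i, Disjoint (A i) (B i)) :
    ∃ F : Set (Cp X × Cp X), DiscreteTopology ↥F ∧
      ∀ (i : ι) (a b : X), a ∈ A i → b ∈ B i →
        ∃ p ∈ F, p.1.1 a ≠ p.1.1 b ∨ p.2.1 a ≠ p.2.1 b := by
  classical
  obtain ⟨n, -, D, hDd, hDc⟩ := hD
  obtain ⟨e⟩ : Nonempty (ι ≃ ↥D) := Cardinal.eq.1 (hι.trans hDc.symm)
  let d : ι → Fin n → X := fun i => (e i).1
  have hdinj : ∀ i j, d i = d j → i = j := fun i j h => e.injective (Subtype.ext h)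
  -- neighbourhood boxes
  have hbox : ∀ i, ∃ U : Fin n → Set X, (∀ k, IsOpen (U k) ∧ d i k ∈ U k) ∧
      ∀ j, (∀ k, d j k ∈ U k) → j = i := by
    intro i
    have h1 : IsOpen ({e i} : Set ↥D) := isOpen_discrete _
    obtain ⟨O, hO, hOe⟩ := isOpen_induced_iff.1 h1
    have hmem : d i ∈ O := by
      have : e i ∈ Subtype.val ⁻¹' O := by rw [hOe]; rfl
      exact this
    obtain ⟨U, hU, hUO⟩ := isOpen_pi_iff'.1 hO (d i) hmem
    refine ⟨U, hU, ?_⟩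
    intro j hj
    have : e j ∈ Subtype.val ⁻¹' O := hUO (fun k _ => hj k)
    rw [hOe] at this
    exact e.injective this
  choose U hU hUi using hbox
  -- coding of coordinate patterns
  let c : Finset (Fin n) → ℕ := fun K => (Fintype.equivFin (Finset (Fin n)) K).1 + 1
  have hc : Function.Injective c := by
    intro K L h
    apply (Fintype.equivFin (Finset (Fin n))).injective
    apply Fin.ext
    simp only [c] at h
    omega
  let M := Fintype.card (Finset (Fin n))
  let P : ι → X → Finset (Fin n) := fun i x => Finset.univ.filter (fun k => d i k = x)
  have hP : ∀ i k, k ∈ P i (d i k) := fun i k => by simp [P]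
  have hpair := fun i => exists_pair (Finset.univ.image (d i)) (A i) (B i) (hA i) (hB i) (hAB i)
    M (fun x => c (P i x)) (fun x _ => by simp [c])
    (fun x _ => (Fintype.equivFin (Finset (Fin n)) (P i x)).2)
    (by
      intro x hx y hy hxy
      have hPe : P i x = P i y := hc hxy
      obtain ⟨k, -, rfl⟩ := Finset.mem_image.1 hx
      have := hP i k
      rw [hPe] at this
      simpa [P] using this)
    (fun x => ⋂ k ∈ P i x, U i k)
    (by
      intro x hx
      constructor
      · exact isOpen_biInter_finset (fun k _ => (hU i k).1)
      · simp only [Set.mem_iInter]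
        intro k hk
        have hk' : d i k = x := by simpa [P] using hk
        rw [← hk']
        exact (hU i k).2)
  choose f g hf hg hval hnear hsep using hpair
  let φ : ι → Cp X × Cp X := fun i => (⟨f i, hf i⟩, ⟨g i, hg i⟩)
  refine ⟨Set.range φ, ?_, ?_⟩
  · rw [discreteTopology_iff_isOpen_singleton]
    rintro ⟨_, i, rfl⟩
    have hev : ∀ x : X, Continuous (fun h : Cp X => h.1 x) := fun x =>
      (continuous_apply x).comp continuous_subtype_val
    refine isOpen_induced_iff.2 ⟨⋂ k : Fin n, {p : Cp X × Cp X |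
      |p.1.1 (d i k) - c (P i (d i k))| < 1 / 2 ∧ |p.2.1 (d i k)| < 1 / (2 * ((M : ℝ) + 1))},
      ?_, ?_⟩
    · refine isOpen_iInter_of_finite (fun k => ?_)
      have c1 : Continuous (fun p : Cp X × Cp X => p.1.1 (d i k)) :=
        (hev (d i k)).comp continuous_fst
      have c2 : Continuous (fun p : Cp X × Cp X => p.2.1 (d i k)) :=
        (hev (d i k)).comp continuous_snd
      exact (isOpen_lt (c1.sub continuous_const).abs continuous_const).inter
        (isOpen_lt c2.abs continuous_const)
    · ext ⟨_, j, rfl⟩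
      simp only [Set.mem_preimage, Set.mem_iInter, Set.mem_setOf_eq, Set.mem_singleton_iff,
        Subtype.mk.injEq]
      constructor
      · intro h
        have : i = j := by
          apply hUi j i
          intro k
          obtain ⟨h1, h2⟩ := h k
          obtain ⟨x, hx, hxc, hxU⟩ := hnear j (d i k) (c (P i (d i k))) (by simp [c]) h1 h2
          have hPe : P j x = P i (d i k) := hc hxc
          have hk : k ∈ P j x := by rw [hPe]; exact hP i k
          exact Set.mem_iInter₂.1 hxU k hk
        rw [this]
      · intro h k
        have hφ : φ j = φ i := congrArg Subtype.val h
        obtain ⟨h1, h2⟩ := hval i (d i k) (Finset.mem_image_of_mem _ (Finset.mem_univ k))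
        have key : |f i (d i k) - c (P i (d i k))| < 1 / 2 ∧
            |g i (d i k)| < 1 / (2 * ((M : ℝ) + 1)) := by
          rw [h1, h2, sub_self, abs_zero]
          constructor
          · norm_num
          · positivity
        have gen : ∀ p : Cp X × Cp X, p = φ i → |p.1.1 (d i k) - c (P i (d i k))| < 1 / 2 ∧
            |p.2.1 (d i k)| < 1 / (2 * ((M : ℝ) + 1)) := by
          rintro p rfl
          exact key
        exact gen (φ j) hφ
  · intro i a b ha hb
    exact ⟨φ i, ⟨i, rfl⟩, hsep i a ha b hb⟩
end

section
/- Let X be an infinite Tychonoff space and m ≥ 1 a natural number. If C_p^m(X) contains a point-separating subspace that is a countable union of discrete subspaces, then C_p^m(X) has a discrete point-separating subspace. -/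
open Cardinal Set

universe u

/-- An embedding of the line in the interval `(4n-2, 4n+2)`. -/
noncomputable def shiftFun (n : ℕ) (t : ℝ) : ℝ := 4 * n + Real.arctan t

theorem shiftFun_mem (n : ℕ) (t : ℝ) : shiftFun n t ∈ Ioo ((4 : ℝ) * n - 2) (4 * n + 2) := by
  have h1 := Real.neg_pi_div_two_lt_arctan t
  have h2 := Real.arctan_lt_pi_div_two t
  have h3 := Real.pi_lt_four
  constructor <;> unfold shiftFun <;> linarith

theorem shiftFun_isEmbedding (n : ℕ) : Topology.IsEmbedding (shiftFun n) := by
  have h : Topology.IsEmbedding Real.arctan := by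
    apply Real.arctan_strictMono.isEmbedding_of_ordConnected
    rw [Real.range_arctan]
    exact ordConnected_Ioo
  exact (Homeomorph.addLeft ((4 : ℝ) * n)).isEmbedding.comp h

/-- Coordinatewise postcomposition with `shiftFun n`. -/
noncomputable def shiftM {X : Type u} [TopologicalSpace X] {m : ℕ} (n : ℕ)
    (f : Fin m → Cp X) : Fin m → Cp X :=
  fun i => ⟨fun x => shiftFun n ((f i).1 x), (shiftFun_isEmbedding n).continuous.comp (f i).2⟩

theorem shiftM_isInducing {X : Type u} [TopologicalSpace X] {m : ℕ} (n : ℕ) :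
    Topology.IsInducing (shiftM n : (Fin m → Cp X) → Fin m → Cp X) := by
  have hval : Topology.IsInducing (fun f : Cp X => f.1) := Topology.IsInducing.subtypeVal
  have h1 : Topology.IsInducing (fun (f : X → ℝ) x => shiftFun n (f x)) :=
    Topology.IsInducing.piMap fun _ => (shiftFun_isEmbedding n).isInducing
  have h2 : Topology.IsInducing (fun f : Cp X =>
      (⟨fun x => shiftFun n (f.1 x), (shiftFun_isEmbedding n).continuous.comp f.2⟩ : Cp X)) :=
    (hval.of_comp_iff).1 (h1.comp hval)
  exact Topology.IsInducing.piMap fun _ => h2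

/-- If `C_p^m(X)` contains a point-separating subspace which is a countable union of
discrete subspaces, then `C_p^m(X)` has a discrete point-separating subspace. -/
theorem stmt12 {X : Type u} [TopologicalSpace X] [T35Space X] [Infinite X]
    (m : ℕ) (hm : 1 ≤ m)
    (hF : ∃ D : ℕ → Set (Fin m → Cp X), (∀ n, DiscreteTopology ↥(D n)) ∧
      PointSepM (⋃ n, D n)) :
    ∃ F : Set (Fin m → Cp X), DiscreteTopology ↥F ∧ PointSepM F := by
  obtain ⟨D, hD, hsep⟩ := hF
  have hne : Nonempty X := inferInstance
  obtain ⟨x0⟩ := hne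
  let i0 : Fin m := ⟨0, hm⟩
  refine ⟨⋃ n, shiftM n '' D n, ?_, ?_⟩
  · rw [discreteTopology_subtype_iff']
    intro y hy
    obtain ⟨n, f, hf, rfl⟩ := mem_iUnion.1 hy
    obtain ⟨U, hU, hUD⟩ := discreteTopology_subtype_iff'.1 (hD n) f hf
    obtain ⟨V, hV, hVU⟩ := (shiftM_isInducing (X := X) (m := m) n).isOpen_iff.1 hU
    have hev : Continuous fun g : Fin m → Cp X => (g i0).1 x0 :=
      (continuous_apply x0).comp (continuous_subtype_val.comp (continuous_apply i0))
    refine ⟨V ∩ {g | (g i0).1 x0 ∈ Ioo ((4 : ℝ) * n - 2) (4 * n + 2)},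
      hV.inter (isOpen_Ioo.preimage hev), ?_⟩
    have hfU : f ∈ U ∩ D n := by rw [hUD]; rfl
    apply Subset.antisymm
    · rintro g ⟨⟨hgV, hg⟩, hgF⟩
      obtain ⟨k, f', hf', rfl⟩ := mem_iUnion.1 hgF
      have hk : k = n := by
        have h1 := shiftFun_mem k ((f' i0).1 x0)
        have h2 : shiftFun k ((f' i0).1 x0) ∈ Ioo ((4 : ℝ) * n - 2) (4 * n + 2) := hg
        have a : (k : ℝ) < n + 1 := by linarith [h1.1, h2.2]
        have b : (n : ℝ) < k + 1 := by linarith [h1.2, h2.1]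
        have a' : k < n + 1 := by exact_mod_cast a
        have b' : n < k + 1 := by exact_mod_cast b
        omega
      subst hk
      have : f' ∈ U ∩ D k := ⟨by rw [← hVU]; exact hgV, hf'⟩
      rw [hUD] at this
      rw [mem_singleton_iff.1 this]
      rfl
    · rintro g rfl
      refine ⟨⟨?_, shiftFun_mem n _⟩, hy⟩
      have := hfU.1
      rw [← hVU] at this
      exact this
  · intro x y hxy
    obtain ⟨f, hf, i, hi⟩ := hsep x y hxy
    obtain ⟨n, hn⟩ := mem_iUnion.1 hf
    exact ⟨shiftM n f, mem_iUnion.2 ⟨n, f, hn, rfl⟩, i,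
      fun h => hi ((shiftFun_isEmbedding n).injective h)⟩
end

section
/- Let X be an infinite zero-dimensional Tychonoff space. Then C_p(X) has a point-separating discrete subspace if and only if C_p^2(X) has a point-separating discrete subspace. -/
open Cardinal Set

universe u

/-- Clopen separation of sublevel sets. -/
theorem aux_clopen {X : Type u} [TopologicalSpace X] (hzd : ZeroDimensional X)
    (g : X → ℝ) (hg : Continuous g) (s t : ℝ) (hst : s < t) :
    ∃ U : Set X, IsClopen U ∧ (∀ x, g x ≤ s → x ∈ U) ∧ (∀ x, t ≤ g x → x ∉ U) := by
  obtain ⟨U, hU, h1, h2⟩ := hzd {x | g x ≤ s} {x | t ≤ g x}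
    ⟨fun x => max (g x - s) 0, by fun_prop, by ext x; simp⟩
    ⟨fun x => max (t - g x) 0, by fun_prop, by ext x; simp⟩
    (by
      rw [Set.disjoint_left]
      intro x hx hx'
      simp only [Set.mem_ofPred_eq] at hx hx'
      linarith)
  exact ⟨U, hU, fun x hx => h1 hx, fun x hx hxU => Set.disjoint_left.1 h2 hxU hx⟩

/-- A sequence of clopen markers. -/
theorem aux_markers {X : Type u} [TopologicalSpace X] [T35Space X] [Infinite X]
    (hzd : ZeroDimensional X) :
    ∃ (O : ℕ → Set X) (z : ℕ → X), (∀ k, IsClopen (O k)) ∧ (∀ k, z k ∈ O k) ∧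
      ∀ k j, k ≠ j → z k ∉ O j := by
  obtain ⟨V, hne, hopen, hdisj⟩ : ∃ V : ℕ → Set X, (∀ n, (V n).Nonempty) ∧ (∀ n, IsOpen (V n)) ∧
      Pairwise (Function.onFun Disjoint V) := by
    obtain ⟨V, h1, h2, h3⟩ := exists_seq_infinite_isOpen_pairwise_disjoint X
    exact ⟨V, fun n => (h1 n).nonempty, h2, h3⟩
  choose z hz using hne
  have : ∀ k, ∃ U : Set X, IsClopen U ∧ z k ∈ U ∧ U ⊆ V k := by
    intro k
    obtain ⟨f, hf, h0, h1⟩ := CompletelyRegularSpace.completely_regular (z k) (V k)ᶜ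
      (hopen k).isClosed_compl (by simpa using hz k)
    obtain ⟨U, hU, ha, hb⟩ := aux_clopen hzd (fun x => (f x : ℝ)) (by fun_prop) 0 1 one_pos
    refine ⟨U, hU, ha _ (by simp [h0]), fun x hx => ?_⟩
    by_contra hxV
    exact hb x (by have := h1 hxV; simp [this]) hx
  choose O hO hzO hOV using this
  exact ⟨O, z, hO, hzO, fun k j hkj h => Set.disjoint_left.1 (hdisj hkj) (hz k) (hOV j h)⟩

theorem aux_discrete {X : Type u} [TopologicalSpace X] (F : Set (Cp X))
    (h : ∀ f ∈ F, ∃ S : Set X, S.Finite ∧ ∀ g ∈ F, (∀ x ∈ S, |g.1 x - f.1 x| < 1) → g = f) :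
    DiscreteTopology ↥F := by
  rw [discreteTopology_subtype_iff']
  intro f hf
  obtain ⟨S, hS, hSf⟩ := h f hf
  refine ⟨⋂ x ∈ S, {g : Cp X | |g.1 x - f.1 x| < 1}, ?_, ?_⟩
  · refine hS.isOpen_biInter fun x _ => ?_
    have hc : Continuous fun g : Cp X => g.1 x :=
      (continuous_apply x).comp continuous_subtype_val
    exact isOpen_lt (hc.sub continuous_const).abs continuous_const
  · ext g
    simp only [Set.mem_inter_iff, Set.mem_iInter, Set.mem_ofPred_eq, Set.mem_singleton_iff]
    constructor
    · rintro ⟨h1, h2⟩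
      exact hSf g h2 h1
    · rintro rfl
      simp [hf]

/-- component of a pair -/
def auxComp {X : Type u} [TopologicalSpace X] (p : Cp X × Cp X) (b : Bool) : X → ℝ :=
  if b then p.1.1 else p.2.1

theorem auxComp_cont {X : Type u} [TopologicalSpace X] (p : Cp X × Cp X) (b : Bool) :
    Continuous (auxComp p b) := by
  cases b
  · exact p.2.2
  · exact p.1.2

theorem aux_nbhd {X : Type u} [TopologicalSpace X] (F : Set (Cp X × Cp X))
    (hF : DiscreteTopology ↥F) (p : Cp X × Cp X) (hp : p ∈ F) :
    ∃ (N : ℕ) (a : Fin N → X × Bool) (ε : ℚ), 0 < ε ∧ ∀ p' ∈ F,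
      (∀ n, |auxComp p' (a n).2 (a n).1 - auxComp p (a n).2 (a n).1| < ε) → p' = p := by
  obtain ⟨U, hU, hUF⟩ := discreteTopology_subtype_iff'.1 hF p hp
  let e : Cp X × Cp X → (X × Bool → ℝ) := fun p y => auxComp p y.2 y.1
  obtain ⟨V, hV, hVU⟩ : ∃ V : Set (X × Bool → ℝ), IsOpen V ∧ e ⁻¹' V = U := by
    have he : Topology.IsInducing e := by
      refine ⟨le_antisymm ?_ ?_⟩
      · rw [← continuous_iff_le_induced]
        refine continuous_pi ?_
        rintro ⟨x, b⟩
        cases b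
        · exact (continuous_apply x).comp (continuous_subtype_val.comp continuous_snd)
        · exact (continuous_apply x).comp (continuous_subtype_val.comp continuous_fst)
      · let _ : TopologicalSpace (Cp X × Cp X) := TopologicalSpace.induced e inferInstance
        have hc : Continuous e := continuous_induced_dom
        have h1 : Continuous (fun p : Cp X × Cp X => p.1) := by
          refine Continuous.subtype_mk (f := fun p : Cp X × Cp X => p.1.1) ?_ _
          exact continuous_pi fun x => (continuous_apply (x, true)).comp hc
        have h2 : Continuous (fun p : Cp X × Cp X => p.2) := by
          refine Continuous.subtype_mk (f := fun p : Cp X × Cp X => p.2.1) ?_ _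
          exact continuous_pi fun x => (continuous_apply (x, false)).comp hc
        exact continuous_id_iff_le.1 (h1.prodMk h2)
    exact he.isOpen_iff.1 hU
  have hpV : e p ∈ V := by
    have : p ∈ U ∩ F := by rw [hUF]; rfl
    rw [← hVU] at this
    exact this.1
  obtain ⟨I, u, hu, hIu⟩ := isOpen_pi_iff.1 hV _ hpV
  have hev : ∀ y : X × Bool, y ∈ I → ∃ δ > 0, Metric.ball (e p y) δ ⊆ u y := fun y hy =>
    Metric.isOpen_iff.1 (hu y hy).1 _ (hu y hy).2
  obtain ⟨δ, hδ, hδI⟩ : ∃ δ > (0:ℝ), ∀ y ∈ I, Metric.ball (e p y) δ ⊆ u y := by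
    have : ∀ᶠ δ in nhdsWithin (0:ℝ) (Set.Ioi 0), ∀ y ∈ I, Metric.ball (e p y) δ ⊆ u y := by
      rw [Filter.eventually_all_finset]
      intro y hy
      obtain ⟨d, hd, hdu⟩ := hev y hy
      filter_upwards [Ioo_mem_nhdsGT hd] with t ht
      exact (Metric.ball_subset_ball ht.2.le).trans hdu
    obtain ⟨δ, h1, h2⟩ := (this.and self_mem_nhdsWithin).exists
    exact ⟨δ, h2, h1⟩
  obtain ⟨ε, hε0, hε⟩ := exists_rat_btwn hδ
  refine ⟨I.card, fun n => (I.equivFin.symm n : X × Bool), ε, by exact_mod_cast hε0, ?_⟩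
  intro p' hp' h
  have : p' ∈ U ∩ F := by
    refine ⟨?_, hp'⟩
    rw [← hVU]
    refine hIu fun y hy => hδI y hy ?_
    have := h (I.equivFin ⟨y, hy⟩)
    simp only [Equiv.symm_apply_apply] at this
    rw [Metric.mem_ball, Real.dist_eq]
    exact this.trans hε
  rw [hUF] at this
  exact this

/-- the countable type of keys -/
abbrev AuxKey := (Σ N : ℕ, ℚ × (Fin N → Bool × ℚ)) × Bool × ℚ × ℚ

theorem aux_main {X : Type u} [TopologicalSpace X] [T35Space X] [Infinite X]
    (hzd : ZeroDimensional X) (F : Set (Cp X × Cp X)) (hF : DiscreteTopology ↥F)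
    (hsep : PointSep2 F) : ∃ F : Set (Cp X), DiscreteTopology ↥F ∧ PointSep1 F := by
  classical
  obtain ⟨O, z, hO, hzO, hzO'⟩ := aux_markers hzd
  obtain ⟨enc, henc⟩ := exists_injective_nat AuxKey
  have hB : ∀ (g : X → ℝ) (s t : ℝ), ∃ U : Set X, IsClopen U ∧ (Continuous g → s < t →
      (∀ x, g x ≤ s → x ∈ U) ∧ (∀ x, t ≤ g x → x ∉ U)) := by
    intro g s t
    by_cases h : Continuous g ∧ s < t
    · obtain ⟨U, h1, h2⟩ := aux_clopen hzd g h.1 s t h.2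
      exact ⟨U, h1, fun _ _ => h2⟩
    · exact ⟨∅, isClopen_empty, fun h1 h2 => absurd ⟨h1, h2⟩ h⟩
  choose B hBc hB using hB
  let c (p : Cp X × Cp X) (κ : AuxKey) (x : X) : Bool × Bool × (Fin κ.1.1 → Bool) :=
    ((O (enc κ)).boolIndicator x, (B (auxComp p κ.2.1) κ.2.2.1 κ.2.2.2).boolIndicator x,
      fun n => (B (fun y => |auxComp p (κ.1.2.2 n).1 y - (κ.1.2.2 n).2|)
        (κ.1.2.1 / 4) (κ.1.2.1 / 2)).boolIndicator x)
  have hc : ∀ p κ, Continuous (c p κ) := by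
    intro p κ
    refine Continuous.prodMk ?_ (Continuous.prodMk ?_ (continuous_pi fun n => ?_))
    · exact (continuous_boolIndicator_iff_isClopen _).2 (hO _)
    · exact (continuous_boolIndicator_iff_isClopen _).2 (hBc _ _ _)
    · exact (continuous_boolIndicator_iff_isClopen _).2 (hBc _ _ _)
  let code (N : ℕ) (v : Bool × Bool × (Fin N → Bool)) : ℕ :=
    Nat.pair (Encodable.encode v.1) (Encodable.encode v.2)
  let H (p : Cp X × Cp X) (κ : AuxKey) : Cp X :=
    ⟨fun x => ((code _ (c p κ x) : ℕ) : ℝ),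
      (continuous_of_discreteTopology (f := fun v => ((code κ.1.1 v : ℕ) : ℝ))).comp (hc p κ)⟩
  have hHval : ∀ p κ x, (H p κ).1 x = ((code _ (c p κ x) : ℕ) : ℝ) := fun _ _ _ => rfl
  let Good (p : Cp X × Cp X) (κ : AuxKey) : Prop := 0 < κ.1.2.1 ∧ ∃ a : Fin κ.1.1 → X,
    (∀ n, |auxComp p (κ.1.2.2 n).1 (a n) - (κ.1.2.2 n).2| ≤ κ.1.2.1 / 4) ∧
    ∀ p' ∈ F, (∀ n, |auxComp p' (κ.1.2.2 n).1 (a n) - auxComp p (κ.1.2.2 n).1 (a n)| < κ.1.2.1) →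
      p' = p
  refine ⟨{h | ∃ p ∈ F, ∃ κ, Good p κ ∧ h = H p κ}, aux_discrete _ ?_, ?_⟩
  · rintro _ ⟨p, hp, κ, ⟨hε, a, ha, hau⟩, rfl⟩
    refine ⟨insert (z (enc κ)) (Set.range a), (Set.finite_range a).insert _, ?_⟩
    rintro _ ⟨p', hp', κ', ⟨hε', -⟩, rfl⟩ hclose
    have heq : ∀ x ∈ insert (z (enc κ)) (Set.range a),
        code _ (c p' κ' x) = code _ (c p κ x) := by
      intro x hx
      have h1 := hclose x hx
      rw [hHval, hHval] at h1
      have h2 : |((code _ (c p' κ' x) : ℕ) : ℤ) - ((code _ (c p κ x) : ℕ) : ℤ)| < 1 := by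
        exact_mod_cast h1
      rw [Int.abs_lt_one_iff] at h2
      omega
    have hκ : κ' = κ := by
      by_contra hne
      have h1 := heq _ (Set.mem_insert _ _)
      have h2 := Encodable.encode_injective (Nat.pair_eq_pair.1 h1).1
      have h3 : (O (enc κ)).boolIndicator (z (enc κ)) = true :=
        (Set.mem_iff_boolIndicator _ _).1 (hzO _)
      have h4 : (O (enc κ')).boolIndicator (z (enc κ)) = false :=
        (Set.notMem_iff_boolIndicator _ _).1 (hzO' _ _ fun h => hne (henc h).symm)
      have h5 : (O (enc κ')).boolIndicator (z (enc κ)) =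
        (O (enc κ)).boolIndicator (z (enc κ)) := h2
      rw [h3, h4] at h5
      exact absurd h5 (by simp)
    subst hκ
    have hεR : (0:ℝ) < (κ'.1.2.1 : ℝ) := by exact_mod_cast hε
    have hcont : ∀ (q : Cp X × Cp X) n,
        Continuous (fun y => |auxComp q (κ'.1.2.2 n).1 y - ((κ'.1.2.2 n).2 : ℝ)|) := by
      intro q n
      have := auxComp_cont q (κ'.1.2.2 n).1
      fun_prop
    have hpp : p' = p := by
      refine hau p' hp' fun n => ?_
      have h1 := heq (a n) (Set.mem_insert_of_mem _ (Set.mem_range_self n))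
      have h2 := Encodable.encode_injective (Nat.pair_eq_pair.1 h1).2
      have h3 := congrFun (congrArg Prod.snd h2) n
      have h4 := (hB _ (κ'.1.2.1 / 4) (κ'.1.2.1 / 2) (hcont p n) (by linarith)).1 (a n) (ha n)
      have h5 : a n ∈ B (fun y => |auxComp p' (κ'.1.2.2 n).1 y - ((κ'.1.2.2 n).2 : ℝ)|)
          (κ'.1.2.1 / 4) (κ'.1.2.1 / 2) := by
        rw [Set.mem_iff_boolIndicator] at h4 ⊢
        exact h3.trans h4
      have h6 : |auxComp p' (κ'.1.2.2 n).1 (a n) - ((κ'.1.2.2 n).2 : ℝ)| < κ'.1.2.1 / 2 := by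
        by_contra hcon
        exact (hB _ (κ'.1.2.1 / 4) (κ'.1.2.1 / 2) (hcont p' n) (by linarith)).2 (a n)
          (not_lt.1 hcon) h5
      have h7 := ha n
      rw [abs_lt] at h6 ⊢
      rw [abs_le] at h7
      constructor <;> linarith [h6.1, h6.2, h7.1, h7.2]
    rw [hpp]
  · -- separation
    have key : ∀ p ∈ F, ∀ b, ∀ x y : X, auxComp p b x < auxComp p b y →
        ∃ f ∈ {h | ∃ p ∈ F, ∃ κ, Good p κ ∧ h = H p κ}, f.1 x ≠ f.1 y := by
      intro p hp b x y hxy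
      obtain ⟨N, a, ε, hε, hu⟩ := aux_nbhd F hF p hp
      have hεR : (0:ℝ) < (ε : ℝ) := by exact_mod_cast hε
      have hq : ∀ n, ∃ q : ℚ, |auxComp p (a n).2 (a n).1 - q| ≤ ε / 4 := by
        intro n
        obtain ⟨q, h1, h2⟩ := exists_rat_btwn
          (show auxComp p (a n).2 (a n).1 < auxComp p (a n).2 (a n).1 + ε / 4 by linarith)
        exact ⟨q, by rw [abs_le]; constructor <;> linarith⟩
      choose q hq using hq
      obtain ⟨s, hs1, hs2⟩ := exists_rat_btwn hxy
      obtain ⟨t, ht1, ht2⟩ := exists_rat_btwn hs2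
      let κ : AuxKey := (⟨N, ε, fun n => ((a n).2, q n)⟩, b, s, t)
      refine ⟨H p κ, ⟨p, hp, κ, ⟨hε, fun n => (a n).1, hq, hu⟩, rfl⟩, fun heq => ?_⟩
      rw [hHval, hHval] at heq
      have h1 : code _ (c p κ x) = code _ (c p κ y) := by exact_mod_cast heq
      have h2 := Encodable.encode_injective (Nat.pair_eq_pair.1 h1).2
      have h3 : (B (auxComp p b) s t).boolIndicator x = (B (auxComp p b) s t).boolIndicator y :=
        congrArg Prod.fst h2
      have h4 := hB (auxComp p b) s t (auxComp_cont p b) ht1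
      have h5 := (Set.mem_iff_boolIndicator _ _).1 (h4.1 x hs1.le)
      have h6 := (Set.notMem_iff_boolIndicator _ _).1 (h4.2 y ht2.le)
      rw [h5, h6] at h3
      exact absurd h3 (by simp)
    have key2 : ∀ p ∈ F, ∀ b, ∀ x y : X, auxComp p b x ≠ auxComp p b y →
        ∃ f ∈ {h | ∃ p ∈ F, ∃ κ, Good p κ ∧ h = H p κ}, f.1 x ≠ f.1 y := by
      intro p hp b x y hxy
      rcases lt_or_gt_of_ne hxy with h | h
      · exact key p hp b x y h
      · obtain ⟨f, hf, hne⟩ := key p hp b y x h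
        exact ⟨f, hf, hne.symm⟩
    intro x y hxy
    obtain ⟨p, hp, h | h⟩ := hsep x y hxy
    · exact key2 p hp true x y h
    · exact key2 p hp false x y h

/-- For zero-dimensional `X`: `C_p(X)` has a point-separating discrete subspace iff
`C_p^2(X)` does. -/
theorem stmt15 {X : Type u} [TopologicalSpace X] [T35Space X] [Infinite X]
    (hzd : ZeroDimensional X) :
    (∃ F : Set (Cp X), DiscreteTopology ↥F ∧ PointSep1 F) ↔
      ∃ F : Set (Cp X × Cp X), DiscreteTopology ↥F ∧ PointSep2 F := by
  constructor
  · rintro ⟨F, hF, hsep⟩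
    refine ⟨(fun f => (f, f)) '' F, ?_, ?_⟩
    · rw [discreteTopology_subtype_iff'] at hF ⊢
      rintro _ ⟨f, hf, rfl⟩
      obtain ⟨U, hU, hUF⟩ := hF f hf
      refine ⟨Prod.fst ⁻¹' U, hU.preimage continuous_fst, ?_⟩
      ext g
      constructor
      · rintro ⟨h1, g, hg, rfl⟩
        have : g ∈ U ∩ F := ⟨h1, hg⟩
        rw [hUF] at this
        rw [Set.mem_singleton_iff] at this ⊢
        rw [this]
      · rintro rfl
        have : f ∈ U ∩ F := by rw [hUF]; rfl
        exact ⟨this.1, f, hf, rfl⟩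
    · intro x y hxy
      obtain ⟨f, hf, h⟩ := hsep x y hxy
      exact ⟨(f, f), ⟨f, hf, rfl⟩, Or.inl h⟩
  · rintro ⟨F, hF, hsep⟩
    exact aux_main hzd F hF hsep
end

section
/- Let X and Y be infinite Tychonoff spaces that are t-equivalent, i.e., C_p(X) is homeomorphic to C_p(Y). If C_p^2(X) has a discrete point-separating subspace, then C_p^2(Y) has a discrete point-separating subspace. -/
open Cardinal Set

universe u

theorem cp_eval_continuous {Y : Type u} [TopologicalSpace Y] (a : Y) :
    Continuous (fun f : Cp Y => f.1 a) :=
  (continuous_apply a).comp continuous_subtype_val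

theorem cp_nhds {Y : Type u} [TopologicalSpace Y] (f : Cp Y) (U : Set (Cp Y))
    (hU : U ∈ nhds f) : ∃ A : Finset Y, ∃ ε : ℝ, 0 < ε ∧
      ∀ g : Cp Y, (∀ a ∈ A, |g.1 a - f.1 a| < ε) → g ∈ U := by
  classical
  have hi : Topology.IsInducing (fun g : Cp Y => g.1) := Topology.IsInducing.subtypeVal
  rw [hi.nhds_eq_comap, nhds_pi, Filter.mem_comap] at hU
  obtain ⟨T, hT, hTU⟩ := hU
  rw [Filter.mem_pi'] at hT
  obtain ⟨A, t, ht, hAt⟩ := hT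
  have h1 : ∀ a, ∃ ε : ℝ, 0 < ε ∧ Metric.ball (f.1 a) ε ⊆ t a := fun a =>
    Metric.mem_nhds_iff.1 (ht a)
  choose e he hball using h1
  obtain ⟨ε, hε, hle⟩ : ∃ ε : ℝ, 0 < ε ∧ ∀ a ∈ A, ε ≤ e a := by
    clear hAt
    induction A using Finset.induction_on with
    | empty => exact ⟨1, one_pos, by simp⟩
    | insert b s hb ih =>
      obtain ⟨ε, hε, h⟩ := ih
      refine ⟨min ε (e b), lt_min hε (he b), ?_⟩
      intro a ha
      rcases Finset.mem_insert.1 ha with rfl | ha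
      · exact min_le_right _ _
      · exact (min_le_left _ _).trans (h a ha)
  refine ⟨A, ε, hε, fun g hg => hTU (hAt ?_)⟩
  intro a ha
  apply hball a
  rw [Metric.mem_ball, Real.dist_eq]
  exact (hg a ha).trans_le (hle a ha)

theorem cp2_nhds {Y : Type u} [TopologicalSpace Y] (f : Cp Y × Cp Y) (U : Set (Cp Y × Cp Y))
    (hU : U ∈ nhds f) : ∃ A : Finset Y, ∃ ε : ℝ, 0 < ε ∧
      ∀ g : Cp Y × Cp Y, (∀ a ∈ A, |g.1.1 a - f.1.1 a| < ε ∧ |g.2.1 a - f.2.1 a| < ε) →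
        g ∈ U := by
  classical
  obtain ⟨U1, h1, U2, h2, hU⟩ := mem_nhds_prod_iff.1 hU
  obtain ⟨A, ε, hε, hA⟩ := cp_nhds _ _ h1
  obtain ⟨B, δ, hδ, hB⟩ := cp_nhds _ _ h2
  refine ⟨A ∪ B, min ε δ, lt_min hε hδ, fun g hg => hU ⟨hA _ ?_, hB _ ?_⟩⟩
  · intro a ha
    exact (hg a (Finset.mem_union_left _ ha)).1.trans_le (min_le_left _ _)
  · intro a ha
    exact (hg a (Finset.mem_union_right _ ha)).2.trans_le (min_le_right _ _)

/-- A point-separating family yields a dense family of no larger (infinite) cardinality. -/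
theorem cp_exists_dense {X : Type u} [TopologicalSpace X] (S : Set (Cp X)) (hS : PointSep1 S) :
    ∃ G : Set (Cp X), Dense G ∧ #G ≤ max #S ℵ₀ := by
  classical
  let S' : Set (X → ℝ) := (fun g : Cp X => g.1) '' S
  let A : Subalgebra ℚ (X → ℝ) := Algebra.adjoin ℚ S'
  have hAcont : ∀ f ∈ A, Continuous f := by
    intro f hf
    induction hf using Algebra.adjoin_induction with
    | mem x hx => obtain ⟨g, _, rfl⟩ := hx; exact g.2
    | algebraMap r => exact continuous_const
    | add x y _ _ hx hy => exact hx.add hy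
    | mul x y _ _ hx hy => exact hx.mul hy
  have hAcard : #A ≤ max #S ℵ₀ := by
    have h := Algebra.lift_cardinalMk_adjoin_le ℚ S'
    have h2 : #S' ≤ #S := mk_image_le
    simp only [lift_uzero, mk_eq_aleph0 ℚ, lift_aleph0] at h
    refine h.trans ?_
    refine max_le (max_le (le_max_right _ _) (h2.trans (le_max_left _ _))) (le_max_right _ _)
  let T : Subring (X → ℝ) := A.toSubring.topologicalClosure
  have hTc : IsClosed (T : Set (X → ℝ)) := Subring.isClosed_topologicalClosure _
  have hAT : ∀ f ∈ A, f ∈ T := fun f hf => Subring.le_topologicalClosure A.toSubring hf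
  have hconst : ∀ r : ℝ, (fun _ : X => r) ∈ T := by
    intro r
    have hc : IsClosed {r : ℝ | (fun _ : X => r) ∈ T} :=
      hTc.preimage (continuous_pi fun _ => continuous_id)
    have hd : Dense (Set.range ((↑) : ℚ → ℝ)) := Rat.denseRange_cast
    have hsub : Set.range ((↑) : ℚ → ℝ) ⊆ {r : ℝ | (fun _ : X => r) ∈ T} := by
      rintro _ ⟨q, rfl⟩
      exact hAT _ (A.algebraMap_mem q)
    exact (hc.closure_subset_iff.2 hsub) (hd r)
  have hST : ∀ s ∈ S, s.1 ∈ T := fun s hs => hAT _ (Algebra.subset_adjoin ⟨s, hs, rfl⟩)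
  -- two-point interpolation
  have htwo : ∀ x y : X, ∃ e ∈ T, x ≠ y → e x = 1 ∧ e y = 0 := by
    intro x y
    by_cases hxy : x = y
    · exact ⟨0, T.zero_mem, fun h => absurd hxy h⟩
    obtain ⟨s, hs, hne⟩ := hS x y hxy
    have hne' : s.1 x - s.1 y ≠ 0 := sub_ne_zero.2 hne
    refine ⟨(s.1 - fun _ => s.1 y) * (fun _ => (s.1 x - s.1 y)⁻¹),
      T.mul_mem (T.sub_mem (hST s hs) (hconst _)) (hconst _), fun _ => ⟨?_, ?_⟩⟩
    · simp [hne']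
    · simp
  choose e heT he using htwo
  have hinterp : ∀ (f : X → ℝ) (I : Finset X), ∃ g ∈ T, ∀ a ∈ I, g a = f a := by
    intro f I
    refine ⟨∑ x ∈ I, (fun _ => f x) * ∏ y ∈ I.erase x, e x y, ?_, ?_⟩
    · exact T.sum_mem fun x _ => T.mul_mem (hconst _) (T.prod_mem fun y _ => heT x y)
    · intro a ha
      rw [Finset.sum_apply, Finset.sum_eq_single a]
      · rw [Pi.mul_apply, Finset.prod_apply, Finset.prod_eq_one, mul_one]
        intro y hy
        exact (he a y (Finset.ne_of_mem_erase hy).symm).1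
      · intro x hx hxa
        rw [Pi.mul_apply, Finset.prod_apply,
          Finset.prod_eq_zero (f := fun c => e x c a) (Finset.mem_erase.2 ⟨hxa.symm, ha⟩)
            (he x a hxa).2, mul_zero]
      · intro h; exact absurd ha h
  have hTall : ∀ f : X → ℝ, f ∈ T := by
    intro f
    have : f ∈ closure (T : Set (X → ℝ)) := by
      rw [mem_closure_iff_nhds]
      intro U hU
      rw [nhds_pi, Filter.mem_pi'] at hU
      obtain ⟨I, t, ht, hI⟩ := hU
      obtain ⟨g, hg, hgf⟩ := hinterp f I
      refine ⟨g, hI ?_, hg⟩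
      intro a ha
      rw [hgf a ha]
      exact mem_of_mem_nhds (ht a)
    rwa [hTc.closure_eq] at this
  refine ⟨{g : Cp X | g.1 ∈ A}, ?_, ?_⟩
  · have hi : Topology.IsInducing (fun g : Cp X => g.1) := Topology.IsInducing.subtypeVal
    intro f
    rw [hi.closure_eq_preimage_closure_image]
    have himg : (fun g : Cp X => g.1) '' {g : Cp X | g.1 ∈ A} = (A : Set (X → ℝ)) := by
      ext f
      constructor
      · rintro ⟨g, hg, rfl⟩; exact hg
      · intro hf; exact ⟨⟨f, hAcont f hf⟩, hf, rfl⟩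
    rw [himg]
    exact hTall f.1
  · refine le_trans ?_ hAcard
    refine mk_le_of_injective (f := fun g => (⟨g.1.1, g.2⟩ : A)) ?_
    intro g h hgh
    have := congrArg Subtype.val hgh
    exact Subtype.ext (Subtype.ext this)

theorem cp_dense_pointSep {Y : Type u} [TopologicalSpace Y] [T35Space Y] (G : Set (Cp Y))
    (hG : Dense G) : PointSep1 G := by
  intro x y hxy
  have ho : IsOpen {f : Cp Y | f.1 x ≠ f.1 y} :=
    isOpen_ne_fun (cp_eval_continuous x) (cp_eval_continuous y)
  obtain ⟨f, hf, hx, hy⟩ := CompletelyRegularSpace.completely_regular x {y} isClosed_singleton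
    (by simpa using hxy)
  have hne : {f : Cp Y | f.1 x ≠ f.1 y}.Nonempty := by
    refine ⟨⟨fun z => (f z : ℝ), continuous_subtype_val.comp hf⟩, ?_⟩
    have hy' : f y = 1 := hy rfl
    change (f x : ℝ) ≠ (f y : ℝ)
    simp [hx, hy']
  obtain ⟨g, hg, hgG⟩ := hG.inter_open_nonempty _ ho hne
  exact ⟨g, hgG, hg⟩

/-- Given a discrete set `D` in the square, at least as large as a separating set `G`, there is a
discrete separating set. -/
theorem cp2_discrete_sep {Y : Type u} [TopologicalSpace Y] [Nonempty Y]
    (D : Set (Cp Y × Cp Y)) (hD : DiscreteTopology D) (G : Set (Cp Y)) (hG : PointSep1 G)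
    (hcard : #G ≤ #D) : ∃ F : Set (Cp Y × Cp Y), DiscreteTopology ↥F ∧ PointSep2 F := by
  classical
  obtain ⟨y0⟩ := ‹Nonempty Y›
  -- a map `h` from `D` whose range contains `G`
  obtain ⟨i⟩ : Nonempty (G ↪ D) := by rwa [Cardinal.le_def] at hcard
  obtain ⟨h, hh⟩ : ∃ h : D → Cp Y, ∀ g ∈ G, ∃ d, h d = g :=
    ⟨Function.extend i Subtype.val (fun _ => ⟨fun _ => 0, continuous_const⟩), fun g hg =>
      ⟨i ⟨g, hg⟩, i.injective.extend_apply _ _ _⟩⟩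
  have hiso : ∀ d : D, ∃ p : ℕ, ∃ A : Finset Y, |d.1.1.1 y0| ≤ p ∧
      ∀ d' : D, (∀ a ∈ A, |d'.1.1.1 a - d.1.1.1 a| < 1 / ((p : ℝ) + 1) ∧
        |d'.1.2.1 a - d.1.2.1 a| < 1 / ((p : ℝ) + 1)) → d' = d := by
    intro d
    obtain ⟨U, hU, hUD⟩ := discreteTopology_subtype_iff'.1 hD d.1 d.2
    have hdU : d.1 ∈ U := by
      have : d.1 ∈ U ∩ D := by rw [hUD]; rfl
      exact this.1
    obtain ⟨A, ε, hε, hA⟩ := cp2_nhds d.1 U (hU.mem_nhds hdU)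
    obtain ⟨n, hn⟩ := exists_nat_one_div_lt hε
    obtain ⟨m, hm⟩ := exists_nat_ge |d.1.1.1 y0|
    have hle : 1 / (((max n m : ℕ) : ℝ) + 1) ≤ ε := by
      refine le_trans ?_ hn.le
      apply one_div_le_one_div_of_le (by positivity)
      have : (n : ℝ) ≤ ((max n m : ℕ) : ℝ) := by exact_mod_cast le_max_left n m
      linarith
    refine ⟨max n m, A, hm.trans (by exact_mod_cast le_max_right n m), ?_⟩
    intro d' hd'
    have hmem : d'.1 ∈ U ∩ D :=
      ⟨hA _ fun a ha => ⟨(hd' a ha).1.trans_le hle, (hd' a ha).2.trans_le hle⟩, d'.2⟩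
    rw [hUD] at hmem
    exact Subtype.ext hmem
  choose p A hp hA using hiso
  let k : D × Bool → ℕ := fun z => 2 * p z.1 + (if z.2 then 1 else 0)
  let w : D × Bool → Y → ℝ := fun z x =>
    (if z.2 then 1 else 0) * (Real.arctan ((h z.1).1 x) * (1 / (8 * ((p z.1 : ℝ) + 1))))
  have hw : ∀ z x, |w z x| ≤ 1 / (4 * ((p z.1 : ℝ) + 1)) := by
    intro z x
    have hat : |Real.arctan ((h z.1).1 x)| ≤ 2 := by
      have h1 := Real.arctan_lt_pi_div_two ((h z.1).1 x)
      have h2 := Real.neg_pi_div_two_lt_arctan ((h z.1).1 x)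
      have h3 := Real.pi_le_four
      rw [abs_le]; constructor <;> linarith
    have hq : (0 : ℝ) < 1 / (8 * ((p z.1 : ℝ) + 1)) := by positivity
    have heq : 1 / (4 * ((p z.1 : ℝ) + 1)) = 2 * (1 / (8 * ((p z.1 : ℝ) + 1))) := by
      field_simp; norm_num
    rw [heq]
    by_cases hz : z.2 = true
    · simp only [w, hz, if_true, one_mul, abs_mul, abs_of_pos hq]
      exact mul_le_mul_of_nonneg_right hat hq.le
    · simp only [w, if_neg hz, zero_mul, abs_zero]
      positivity
  have hwc : ∀ z, Continuous (w z) := fun z =>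
    continuous_const.mul ((Real.continuous_arctan.comp (h z.1).2).mul continuous_const)
  let E : D × Bool → Cp Y × Cp Y := fun z =>
    (⟨fun x => z.1.1.1.1 x + ((k z : ℝ) + 2) ^ 2 + w z x,
      (z.1.1.1.2.add continuous_const).add (hwc z)⟩, z.1.1.2)
  have hlevel : ∀ z, |(E z).1.1 y0 - ((k z : ℝ) + 2) ^ 2| < (k z : ℝ) + 2 := by
    intro z
    have h1 := hp z.1
    have h2 := hw z y0
    have h3 : 1 / (4 * ((p z.1 : ℝ) + 1)) ≤ 1 := by
      rw [div_le_one (by positivity)]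
      have : (0 : ℝ) ≤ p z.1 := Nat.cast_nonneg _
      linarith
    have h4 : (p z.1 : ℝ) ≤ k z := by
      have : p z.1 ≤ k z := by simp only [k]; omega
      exact_mod_cast this
    have h5 : (E z).1.1 y0 - ((k z : ℝ) + 2) ^ 2 = z.1.1.1.1 y0 + w z y0 := by
      simp only [E]; ring
    rw [h5]
    have := abs_add_le (z.1.1.1.1 y0) (w z y0)
    linarith
  have hdisj : ∀ (m n : ℕ) (t : ℝ), |t - ((m : ℝ) + 2) ^ 2| < (m : ℝ) + 2 →
      |t - ((n : ℝ) + 2) ^ 2| < (n : ℝ) + 2 → ¬ m < n := by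
    intro m n t h1 h2 hlt
    rw [abs_lt] at h1 h2
    have hmn : (m : ℝ) + 1 ≤ n := by exact_mod_cast hlt
    have hm0 : (0 : ℝ) ≤ m := Nat.cast_nonneg _
    nlinarith
  refine ⟨Set.range E, ?_, ?_⟩
  · rw [discreteTopology_subtype_iff']
    rintro _ ⟨z, rfl⟩
    let δ : ℝ := 1 / (2 * ((p z.1 : ℝ) + 1))
    have hδ : 0 < δ := by positivity
    let U : Set (Cp Y × Cp Y) := {q | |q.1.1 y0 - ((k z : ℝ) + 2) ^ 2| < (k z : ℝ) + 2} ∩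
      ⋂ a ∈ A z.1, ({q | |q.1.1 a - (E z).1.1 a| < δ} ∩ {q | |q.2.1 a - (E z).2.1 a| < δ})
    have c1 : ∀ a, Continuous fun q : Cp Y × Cp Y => q.1.1 a := fun a =>
      (cp_eval_continuous a).comp continuous_fst
    have c2 : ∀ a, Continuous fun q : Cp Y × Cp Y => q.2.1 a := fun a =>
      (cp_eval_continuous a).comp continuous_snd
    refine ⟨U, ?_, ?_⟩
    · refine IsOpen.inter (isOpen_lt ((c1 y0).sub continuous_const).abs continuous_const) ?_
      refine isOpen_biInter_finset fun a _ => ?_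
      exact (isOpen_lt ((c1 a).sub continuous_const).abs continuous_const).inter
        (isOpen_lt ((c2 a).sub continuous_const).abs continuous_const)
    · apply Set.Subset.antisymm
      · rintro _ ⟨⟨hq0, hq⟩, ⟨z', rfl⟩⟩
        have hkk : k z' = k z := by
          have n1 := hdisj _ _ _ (hlevel z') hq0
          have n2 := hdisj _ _ _ hq0 (hlevel z')
          omega
        have hpb : p z'.1 = p z.1 ∧ z'.2 = z.2 := by
          simp only [k] at hkk
          rcases hz : z.2 <;> rcases hz' : z'.2 <;> simp [hz, hz'] at hkk ⊢ <;> omega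
        have hd : z'.1 = z.1 := by
          apply hA
          intro a ha
          have hqa := Set.mem_iInter₂.1 hq a ha
          obtain ⟨ha1, ha2⟩ := hqa
          have ha1' : |(E z').1.1 a - (E z).1.1 a| < δ := ha1
          have ha2' : |z'.1.1.2.1 a - z.1.1.2.1 a| < δ := ha2
          have w1 := hw z a
          have w2 := hw z' a
          rw [hpb.1] at w2
          have hr : 0 < 1 / ((p z.1 : ℝ) + 1) := by positivity
          have e1 : δ = (1 / ((p z.1 : ℝ) + 1)) / 2 := by simp only [δ]; field_simp
          have e2 : 1 / (4 * ((p z.1 : ℝ) + 1)) = (1 / ((p z.1 : ℝ) + 1)) / 4 := by field_simp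
          rw [e2] at w1 w2
          rw [e1] at ha1' ha2'
          have e3 : (E z').1.1 a - (E z).1.1 a
              = z'.1.1.1.1 a - z.1.1.1.1 a + w z' a - w z a := by
            simp only [E, hkk]; ring
          rw [e3] at ha1'
          rw [abs_lt] at ha1' ha2'
          rw [abs_le] at w1 w2
          constructor <;> rw [abs_lt] <;> constructor <;> linarith
        have : z' = z := Prod.ext hd hpb.2
        rw [this]; rfl
      · rintro _ rfl
        refine ⟨⟨hlevel z, ?_⟩, ⟨z, rfl⟩⟩
        refine Set.mem_iInter₂.2 fun a _ => ⟨?_, ?_⟩ <;> simpa using hδ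
  · intro x y hxy
    obtain ⟨g, hg, hgxy⟩ := hG x y hxy
    obtain ⟨d, rfl⟩ := hh g hg
    by_contra hcon
    push Not at hcon
    have h0 := (hcon (E (d, false)) ⟨_, rfl⟩).1
    have h1 := (hcon (E (d, true)) ⟨_, rfl⟩).1
    simp only [E, w, if_true, Bool.false_eq_true, if_false, zero_mul, one_mul, add_zero] at h0 h1
    have h2 : Real.arctan ((h d).1 x) * (1 / (8 * ((p d : ℝ) + 1)))
        = Real.arctan ((h d).1 y) * (1 / (8 * ((p d : ℝ) + 1))) := by linarith
    have hq : (1 / (8 * ((p d : ℝ) + 1))) ≠ 0 := by positivity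
    exact hgxy (Real.arctan_injective (mul_right_cancel₀ hq h2))

/-- The constants give a countably infinite discrete set. -/
theorem cp2_countable_discrete {Y : Type u} [TopologicalSpace Y] [Nonempty Y] :
    ∃ D : Set (Cp Y × Cp Y), DiscreteTopology D ∧ ℵ₀ ≤ #D := by
  obtain ⟨y0⟩ := ‹Nonempty Y›
  let c : ℕ → Cp Y × Cp Y := fun n => (⟨fun _ => n, continuous_const⟩, ⟨fun _ => 0, continuous_const⟩)
  have hc : ∀ n, (c n).1.1 y0 = n := fun n => rfl
  have hinj : Function.Injective c := by
    intro m n hmn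
    have : (c m).1.1 y0 = (c n).1.1 y0 := by rw [hmn]
    rw [hc, hc] at this
    exact_mod_cast this
  refine ⟨Set.range c, ?_, ?_⟩
  · rw [discreteTopology_subtype_iff']
    rintro _ ⟨n, rfl⟩
    refine ⟨{q | |q.1.1 y0 - n| < 1}, isOpen_lt ((((cp_eval_continuous y0).comp
      continuous_fst).sub continuous_const).abs) continuous_const, ?_⟩
    apply Set.Subset.antisymm
    · rintro _ ⟨hm, ⟨m, rfl⟩⟩
      have hm' : |(m : ℝ) - n| < 1 := hm
      have h2 : |(m : ℤ) - n| < 1 := by exact_mod_cast hm'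
      rw [Int.abs_lt_one_iff] at h2
      have : m = n := by omega
      rw [this]; rfl
    · rintro _ rfl
      refine ⟨?_, ⟨n, rfl⟩⟩
      simp [hc]
  · rw [Cardinal.aleph0_le_mk_iff]
    exact Set.infinite_coe_iff.2 (Set.infinite_range_of_injective hinj)

/-- If `X` and `Y` are `t`-equivalent and `C_p^2(X)` has a discrete point-separating
subspace, then so does `C_p^2(Y)`. -/
theorem stmt16 {X Y : Type u} [TopologicalSpace X] [T35Space X] [Infinite X]
    [TopologicalSpace Y] [T35Space Y] [Infinite Y]
    (htequiv : Nonempty (Cp X ≃ₜ Cp Y))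
    (hF : ∃ F : Set (Cp X × Cp X), DiscreteTopology ↥F ∧ PointSep2 F) :
    ∃ F : Set (Cp Y × Cp Y), DiscreteTopology ↥F ∧ PointSep2 F := by
  obtain ⟨Φ⟩ := htequiv
  obtain ⟨F, hFd, hFs⟩ := hF
  have hS : PointSep1 (Prod.fst '' F ∪ Prod.snd '' F) := by
    intro x y hxy
    obtain ⟨q, hq, h | h⟩ := hFs x y hxy
    · exact ⟨q.1, Or.inl ⟨q, hq, rfl⟩, h⟩
    · exact ⟨q.2, Or.inr ⟨q, hq, rfl⟩, h⟩
  obtain ⟨G, hGd, hGc⟩ := cp_exists_dense _ hS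
  have hGc' : #G ≤ max #F ℵ₀ := by
    refine hGc.trans (max_le ?_ (le_max_right _ _))
    refine (mk_union_le _ _).trans ?_
    have h1 : #(Prod.fst '' F : Set (Cp X)) ≤ max #F ℵ₀ := mk_image_le.trans (le_max_left _ _)
    have h2 : #(Prod.snd '' F : Set (Cp X)) ≤ max #F ℵ₀ := mk_image_le.trans (le_max_left _ _)
    exact Cardinal.add_le_of_le (le_max_right _ _) h1 h2
  have hGY : PointSep1 (Φ '' G) :=
    cp_dense_pointSep _ (Φ.surjective.denseRange.dense_image Φ.continuous hGd)
  have hGYc : #(Φ '' G : Set (Cp Y)) ≤ max #F ℵ₀ := mk_image_le.trans hGc'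
  by_cases hinf : ℵ₀ ≤ #F
  · rw [max_eq_left hinf] at hGYc
    let Ψ : Cp X × Cp X ≃ₜ Cp Y × Cp Y := Φ.prodCongr Φ
    refine cp2_discrete_sep (Ψ '' F) ?_ _ hGY ?_
    · exact (Ψ.image F).symm.isEmbedding.discreteTopology
    · rwa [mk_image_eq Ψ.injective]
  · rw [max_eq_right (not_le.1 hinf).le] at hGYc
    obtain ⟨D, hD, hDc⟩ := cp2_countable_discrete (Y := Y)
    exact cp2_discrete_sep D hD _ hGY (hGYc.trans hDc)
end

section
/- Let X and Y be infinite zero-dimensional Tychonoff spaces that are t-equivalent, i.e., C_p(X) is homeomorphic to C_p(Y). If C_p(X) has a discrete point-separating subspace, then C_p(Y) has a discrete point-separating subspace. -/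
open Cardinal Set

universe u

theorem aux_sep {Y : Type u} [TopologicalSpace Y] (hzd : ZeroDimensional Y)
    (D : Set (Cp Y)) (hD : DiscreteTopology ↥D) {ι : Type u} (S : ι → Cp Y)
    (hS : PointSep1 (Set.range S)) (e : ι × ℚ × ℚ ↪ ↥D) :
    ∃ F : Set (Cp Y), DiscreteTopology ↥F ∧ PointSep1 F := by
  classical
  have hfc : ∀ A : ℝ → ℝ, Continuous A → ∀ i, FunctionallyClosed {y | A ((S i).1 y) = 0} :=
    fun A hA i => ⟨fun y => A ((S i).1 y), hA.comp (S i).2, rfl⟩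
  have hU : ∀ t : ι × ℚ × ℚ, ∃ U : Set Y, IsClopen U ∧ ((t.2.1 : ℝ) < t.2.2 →
      (∀ y, (S t.1).1 y ≤ t.2.1 → y ∈ U) ∧ (∀ y, (t.2.2 : ℝ) ≤ (S t.1).1 y → y ∉ U)) := by
    rintro ⟨i, p, q⟩
    by_cases hpq : (p : ℝ) < q
    · obtain ⟨U, hU, h1, h2⟩ := hzd _ _
        (hfc (fun r => max (r - p) 0) (by fun_prop) i)
        (hfc (fun r => max (q - r) 0) (by fun_prop) i) (by
          rw [Set.disjoint_left]
          intro y hy hy'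
          simp only [Set.mem_ofPred_eq, max_eq_right_iff] at hy hy'
          linarith)
      refine ⟨U, hU, fun _ => ⟨fun y hy => h1 ?_, fun y hy hyU => ?_⟩⟩
      · simp only [Set.mem_ofPred_eq, max_eq_right_iff]
        linarith
      · refine Set.disjoint_left.1 h2 hyU ?_
        simp only [Set.mem_ofPred_eq, max_eq_right_iff]
        linarith
    · exact ⟨∅, isClopen_empty, fun h => absurd h hpq⟩
  choose U hUc hUs using hU
  let h : ι × ℚ × ℚ → Cp Y := fun t =>
    ⟨fun y => Real.arctan ((e t).1.1 y) + (U t).indicator (fun _ => Real.pi) y,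
      (Real.continuous_arctan.comp (e t).1.2).add
        (continuous_const.indicator (by simp [(hUc t).frontier_eq]))⟩
  have htan : ∀ t y, Real.tan ((h t).1 y) = (e t).1.1 y := by
    intro t y
    by_cases hy : y ∈ U t
    · simp [h, hy, Real.tan_add_pi, Real.tan_arctan]
    · simp [h, hy, Real.tan_arctan]
  have hcos : ∀ t y, Real.cos ((h t).1 y) ≠ 0 := by
    intro t y
    have := (Real.cos_arctan_pos ((e t).1.1 y)).ne'
    by_cases hy : y ∈ U t
    · simp only [h, hy, Set.indicator_of_mem, Real.cos_add_pi]
      exact neg_ne_zero.2 this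
    · simpa only [h, hy, Set.indicator_of_notMem, not_false_eq_true, add_zero] using this
  refine ⟨Set.range h, ?_, ?_⟩
  · choose g hg using fun z : ↥(Set.range h) => z.2
    have hc : Continuous (fun z : ↥(Set.range h) => e (g z)) := by
      rw [continuous_induced_rng]
      refine Continuous.subtype_mk (f := fun z : ↥(Set.range h) => (e (g z)).1.1) ?_ _
      refine continuous_pi fun y => ?_
      have he : (fun z : ↥(Set.range h) => (e (g z)).1.1 y) =
          fun z : ↥(Set.range h) => Real.tan (z.1.1 y) := by
        funext z
        rw [← htan, hg]
      rw [he, continuous_iff_continuousAt]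
      intro z
      have hz : Real.cos (z.1.1 y) ≠ 0 := by
        rw [← hg z]
        exact hcos _ _
      have hev : Continuous (fun z : ↥(Set.range h) => z.1.1 y) :=
        (continuous_apply y).comp (continuous_subtype_val.comp continuous_subtype_val)
      exact ContinuousAt.comp (f := fun z : ↥(Set.range h) => z.1.1 y)
        (Real.continuousAt_tan.2 hz) hev.continuousAt
    refine DiscreteTopology.of_continuous_injective hc ?_
    intro z w hzw
    have := e.injective hzw
    apply Subtype.ext
    rw [← hg z, ← hg w, this]
  · have key : ∀ x y : Y, ∀ i, (S i).1 x < (S i).1 y → ∃ t, (h t).1 x ≠ (h t).1 y := by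
      intro x y i hi
      obtain ⟨p, hp1, hp2⟩ := exists_rat_btwn hi
      obtain ⟨q, hq1, hq2⟩ := exists_rat_btwn hp2
      obtain ⟨h1, h2⟩ := hUs (i, p, q) hq1
      have hx := h1 x hp1.le
      have hy := h2 y hq2.le
      refine ⟨(i, p, q), ?_⟩
      simp only [h, hx, hy, Set.indicator_of_mem, Set.indicator_of_notMem, not_false_eq_true,
        add_zero]
      have a1 := Real.neg_pi_div_two_lt_arctan ((e (i, p, q)).1.1 x)
      have a2 := Real.arctan_lt_pi_div_two ((e (i, p, q)).1.1 y)
      intro h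
      linarith
    intro x y hxy
    obtain ⟨_, ⟨i, rfl⟩, hi⟩ := hS x y hxy
    rcases lt_or_gt_of_ne hi with hi | hi
    · obtain ⟨t, ht⟩ := key x y i hi
      exact ⟨_, ⟨t, rfl⟩, ht⟩
    · obtain ⟨t, ht⟩ := key y x i hi
      exact ⟨_, ⟨t, rfl⟩, ht.symm⟩

/-- A closed subring of `X → ℝ` containing constants and separating points is everything. -/
theorem aux_subring {X : Type u} (R : Subring (X → ℝ)) (hR : IsClosed (R : Set (X → ℝ)))
    (hc : ∀ r : ℝ, (fun _ => r) ∈ R)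
    (hs : ∀ x y : X, x ≠ y → ∃ f ∈ R, f x ≠ f y) (g : X → ℝ) : g ∈ R := by
  classical
  choose! f hf hfx using hs
  have hL : ∀ K : Finset X, ∃ k ∈ R, ∀ x ∈ K, k x = g x := by
    intro K
    refine ⟨∑ x ∈ K, (fun _ => g x) * ∏ y ∈ K.erase x,
      ((f x y - fun _ => f x y y) * fun _ => (f x y x - f x y y)⁻¹), ?_, ?_⟩
    · refine R.sum_mem fun x _ => R.mul_mem (hc _) (R.prod_mem fun y hy => ?_)
      exact R.mul_mem (R.sub_mem (hf _ _ (Finset.ne_of_mem_erase hy).symm) (hc _)) (hc _)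
    · intro z hz
      rw [Finset.sum_apply, Finset.sum_eq_single_of_mem z hz]
      · simp only [Pi.mul_apply, Finset.prod_apply, Pi.sub_apply]
        rw [Finset.prod_eq_one, mul_one]
        intro y hy
        exact mul_inv_cancel₀ (sub_ne_zero.2 (hfx _ _ (Finset.ne_of_mem_erase hy).symm))
      · intro x _ hxz
        simp only [Pi.mul_apply, Finset.prod_apply, Pi.sub_apply]
        rw [Finset.prod_eq_zero (i := z), mul_zero]
        · exact Finset.mem_erase.2 ⟨hxz.symm, hz⟩
        · simp
  choose k hk hkg using hL
  have ht : Filter.Tendsto k Filter.atTop (nhds g) := by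
    rw [tendsto_pi_nhds]
    intro x
    refine tendsto_const_nhds.congr' ?_
    filter_upwards [Filter.eventually_ge_atTop {x}] with K hK
    exact (hkg K x (hK (Finset.mem_singleton_self x))).symm
  exact hR.mem_of_tendsto ht (Filter.Eventually.of_forall hk)

theorem aux_dense {X : Type u} [TopologicalSpace X] (F : Set (Cp X)) (hF : PointSep1 F) :
    ∃ P : MvPolynomial ↥F ℚ → Cp X, DenseRange P := by
  let φ : MvPolynomial ↥F ℚ →ₐ[ℚ] (X → ℝ) := MvPolynomial.aeval (fun f : ↥F => f.1.1)
  have hφ : ∀ p, Continuous (φ p) := by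
    intro p
    induction p using MvPolynomial.induction_on with
    | C a =>
      have : φ (MvPolynomial.C a) = fun _ => (a : ℝ) := by
        funext x
        simp [φ]
      rw [this]
      exact continuous_const
    | add p q hp hq =>
      rw [map_add]
      exact hp.add hq
    | mul_X p f hp =>
      have : φ (MvPolynomial.X f) = f.1.1 := by simp [φ]
      rw [map_mul, this]
      exact hp.mul f.1.2
  refine ⟨fun p => ⟨φ p, hφ p⟩, ?_⟩
  let R : Subring (X → ℝ) := (φ : MvPolynomial ↥F ℚ →+* (X → ℝ)).range.topologicalClosure
  have hRc : IsClosed (R : Set (X → ℝ)) := Subring.isClosed_topologicalClosure _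
  have hsub : ∀ p, φ p ∈ R := fun p => Subring.le_topologicalClosure _ ⟨p, rfl⟩
  have hall := aux_subring R hRc (by
      intro r
      have hcl : IsClosed {r : ℝ | (fun _ : X => r) ∈ R} :=
        hRc.preimage (continuous_pi fun _ => continuous_id)
      have hd : Dense {r : ℝ | (fun _ : X => r) ∈ R} := by
        refine (Rat.denseRange_cast (𝕜 := ℝ)).mono ?_
        rintro _ ⟨a, rfl⟩
        have : φ (MvPolynomial.C a) = fun _ => (a : ℝ) := by
          funext x
          simp [φ]
        rw [Set.mem_ofPred_eq, ← this]
        exact hsub _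
      have := hd.closure_eq
      rw [hcl.closure_eq] at this
      exact Set.eq_univ_iff_forall.1 this r)
    (by
      intro x y hxy
      obtain ⟨f, hf, hne⟩ := hF x y hxy
      refine ⟨f.1, ?_, hne⟩
      have : φ (MvPolynomial.X ⟨f, hf⟩) = f.1 := by simp [φ]
      rw [← this]
      exact hsub _)
  intro g
  have hg : g.1 ∈ closure (Set.range φ) := hall g.1
  have hind : Topology.IsInducing (fun f : Cp X => f.1) := Topology.IsInducing.subtypeVal
  rw [hind.closure_eq_preimage_closure_image, Set.mem_preimage]
  refine closure_mono ?_ hg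
  rintro _ ⟨p, rfl⟩
  exact ⟨_, ⟨p, rfl⟩, rfl⟩

theorem aux_const {X : Type u} [TopologicalSpace X] [Infinite X] :
    ∃ D : Set (Cp X), DiscreteTopology ↥D ∧ Infinite ↥D := by
  obtain ⟨x⟩ : Nonempty X := inferInstance
  let c : ℕ → Cp X := fun n => ⟨fun _ => n, continuous_const⟩
  have hinj : Function.Injective c := by
    intro m n h
    have := congrArg (fun f : Cp X => f.1 x) h
    simpa [c] using this
  refine ⟨Set.range c, ?_, (Set.infinite_range_of_injective hinj).to_subtype⟩
  choose g hg using fun z : ↥(Set.range c) => z.2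
  have hev : Continuous (fun z : ↥(Set.range c) => z.1.1 x) :=
    (continuous_apply x).comp (continuous_subtype_val.comp continuous_subtype_val)
  have hc : Continuous g := by
    rw [Nat.isClosedEmbedding_coe_real.isInducing.continuous_iff]
    convert hev using 2 with z
    have := congrArg (fun f : Cp X => f.1 x) (hg z)
    simpa [c] using this
  refine DiscreteTopology.of_continuous_injective hc ?_
  intro z w hzw
  apply Subtype.ext
  rw [← hg z, ← hg w, hzw]

/-- If `X` and `Y` are zero-dimensional and `t`-equivalent and `C_p(X)` has a discrete
point-separating subspace, then so does `C_p(Y)`. -/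
theorem stmt17 {X Y : Type u} [TopologicalSpace X] [T35Space X] [Infinite X]
    [TopologicalSpace Y] [T35Space Y] [Infinite Y]
    (hzdX : ZeroDimensional X) (hzdY : ZeroDimensional Y)
    (htequiv : Nonempty (Cp X ≃ₜ Cp Y))
    (hF : ∃ F : Set (Cp X), DiscreteTopology ↥F ∧ PointSep1 F) :
    ∃ F : Set (Cp Y), DiscreteTopology ↥F ∧ PointSep1 F := by
  obtain ⟨Φ⟩ := htequiv
  obtain ⟨F, hFd, hFs⟩ := hF
  obtain ⟨P, hP⟩ := aux_dense F hFs
  obtain ⟨D, hDd, hDi, hFD⟩ : ∃ D : Set (Cp X), DiscreteTopology ↥D ∧ Infinite ↥D ∧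
      #↥F ≤ #↥D := by
    by_cases hfin : Infinite ↥F
    · exact ⟨F, hFd, hfin, le_rfl⟩
    · obtain ⟨D, h1, h2⟩ := aux_const (X := X)
      refine ⟨D, h1, h2, ?_⟩
      have : Finite ↥F := not_infinite_iff_finite.1 hfin
      exact (Cardinal.lt_aleph0_of_finite _).le.trans (Cardinal.aleph0_le_mk _)
  have hD0 : ℵ₀ ≤ #↥D := Cardinal.aleph0_le_mk _
  have hM : #(MvPolynomial ↥F ℚ) ≤ #↥D := by
    refine MvPolynomial.cardinalMk_le_max_lift.trans ?_
    simp [hD0, hFD]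
  have hcard : #(MvPolynomial ↥F ℚ × ℚ × ℚ) ≤ #↥D := by
    have hq : #(ℚ × ℚ) = ℵ₀ := by simp
    rw [Cardinal.mk_prod, hq]
    simp only [Cardinal.lift_aleph0, Cardinal.lift_uzero]
    exact Cardinal.mul_le_of_le hD0 hM hD0
  have hcard' : #(MvPolynomial ↥F ℚ × ℚ × ℚ) ≤ #↥(Φ '' D) := by
    rwa [Cardinal.mk_image_eq Φ.injective]
  obtain ⟨e⟩ := Cardinal.le_def _ _ |>.1 hcard'
  refine aux_sep hzdY (Φ '' D) (Φ.image D).symm.isEmbedding.discreteTopology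
    (fun p => Φ (P p)) ?_ e
  have hdense : DenseRange (fun p => Φ (P p)) := Φ.surjective.denseRange.comp hP Φ.continuous
  intro x y hxy
  have hev : ∀ y : Y, Continuous (fun f : Cp Y => f.1 y) := fun y =>
    (continuous_apply y).comp continuous_subtype_val
  have hopen : IsOpen {f : Cp Y | f.1 x ≠ f.1 y} := isOpen_ne_fun (hev x) (hev y)
  have hne : {f : Cp Y | f.1 x ≠ f.1 y}.Nonempty := by
    obtain ⟨f, hf, h0, h1⟩ := CompletelyRegularSpace.completely_regular x {y} isClosed_singleton
      (by simpa using hxy)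
    refine ⟨⟨fun z => (f z : ℝ), continuous_subtype_val.comp hf⟩, ?_⟩
    have h1' := h1 (Set.mem_singleton y)
    show (f x : ℝ) ≠ (f y : ℝ)
    rw [h0, h1']
    simp
  obtain ⟨p, hp⟩ := hdense.exists_mem_open hopen hne
  exact ⟨_, ⟨p, rfl⟩, hp⟩
end

section
/- Let X be an infinite Tychonoff space. Then C_p(X) has a point-separating subset homeomorphic to the closed unit interval [0,1] if and only if X admits a continuous injection into ℝ^ω (the countable product of real lines with the product topology). -/
open Cardinal Set

universe u

noncomputable section

/-- the knots `a n = 1 - 1/(n+1)` -/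
def knot (n : ℕ) : ℝ := 1 - 1 / ((n : ℝ) + 1)

/-- ramps starting at the knots -/
def ramp (n : ℕ) (t : ℝ) : ℝ := max 0 (t - knot n)

lemma knot_strictMono : StrictMono knot := by
  apply strictMono_nat_of_lt_succ
  intro n
  unfold knot
  have h : (1 : ℝ) / (((n + 1 : ℕ) : ℝ) + 1) < 1 / ((n : ℝ) + 1) := by
    apply one_div_lt_one_div_of_lt
    · positivity
    · push_cast; linarith
  linarith

lemma knot_nonneg (n : ℕ) : 0 ≤ knot n := by
  have h := knot_strictMono.monotone (Nat.zero_le n)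
  simpa [knot] using h

lemma knot_le_one (n : ℕ) : knot n ≤ 1 := by
  unfold knot
  have : (0 : ℝ) ≤ 1 / ((n : ℝ) + 1) := by positivity
  linarith

lemma ramp_nonneg (n : ℕ) (t : ℝ) : 0 ≤ ramp n t := le_max_left _ _

lemma ramp_le_one (n : ℕ) (t : ℝ) (ht : t ≤ 1) : ramp n t ≤ 1 := by
  have := knot_nonneg n
  exact max_le (by norm_num) (by linarith)

lemma ramp_mono (n : ℕ) {s t : ℝ} (h : s ≤ t) : ramp n s ≤ ramp n t :=
  max_le_max le_rfl (by linarith)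

lemma ramp_continuous (n : ℕ) : Continuous (ramp n) := by
  unfold ramp; fun_prop

/-- squashed values, lying in `[0,4]` -/
def squash (u : ℝ) : ℝ := Real.arctan u + 2

lemma squash_nonneg (u : ℝ) : 0 ≤ squash u := by
  have := Real.neg_pi_div_two_lt_arctan u
  have := Real.pi_le_four
  unfold squash; linarith

lemma squash_le (u : ℝ) : squash u ≤ 4 := by
  have := Real.arctan_lt_pi_div_two u
  have := Real.pi_le_four
  unfold squash; linarith

lemma squash_injective : Function.Injective squash := by
  intro u v h
  exact Real.arctan_injective (by simpa [squash] using h)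

lemma squash_continuous : Continuous squash := by
  unfold squash
  exact Real.continuous_arctan.add continuous_const

/-- the general term -/
def pterm (a : ℕ → ℝ) (t : ℝ) (n : ℕ) : ℝ := 4 * (1 / 2 : ℝ) ^ n * (squash (a n) / 4 * ramp n t)

lemma pterm_nonneg (a : ℕ → ℝ) (t : ℝ) (n : ℕ) : 0 ≤ pterm a t n := by
  have := squash_nonneg (a n)
  have := ramp_nonneg n t
  unfold pterm; positivity

lemma pterm_le (a : ℕ → ℝ) (t : ℝ) (ht : t ≤ 1) (n : ℕ) :
    pterm a t n ≤ 4 * (1 / 2 : ℝ) ^ n := by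
  have h1 := squash_nonneg (a n)
  have h2 := ramp_nonneg n t
  have h3 := squash_le (a n)
  have h4 := ramp_le_one n t ht
  unfold pterm
  have h5 : squash (a n) / 4 * ramp n t ≤ 1 := mul_le_one₀ (by linarith) h2 h4
  exact mul_le_of_le_one_right (by positivity) h5

lemma summable_bound : Summable (fun n : ℕ => 4 * (1 / 2 : ℝ) ^ n) :=
  summable_geometric_two.mul_left 4

lemma pterm_summable (a : ℕ → ℝ) (t : ℝ) (ht : t ≤ 1) : Summable (pterm a t) :=
  Summable.of_nonneg_of_le (pterm_nonneg a t) (pterm_le a t ht) summable_bound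

/-- the path -/
def path (a : ℕ → ℝ) (t : ℝ) : ℝ := t + ∑' n, pterm a t n

lemma path_strictMono (a : ℕ → ℝ) {s t : ℝ} (h : s < t) (ht : t ≤ 1) : path a s < path a t := by
  unfold path
  have : ∑' n, pterm a s n ≤ ∑' n, pterm a t n := by
    apply Summable.tsum_le_tsum _ (pterm_summable a s (h.le.trans ht)) (pterm_summable a t ht)
    intro n
    have h1 := squash_nonneg (a n)
    have := ramp_mono n h.le
    unfold pterm
    gcongr
  linarith

lemma path_continuous {Y : Type*} [TopologicalSpace Y] (a : Y → ℕ → ℝ) (t : Y → ℝ)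
    (ha : Continuous a) (ht : Continuous t) (ht1 : ∀ y, t y ≤ 1) :
    Continuous (fun y => path (a y) (t y)) := by
  unfold path
  refine ht.add (continuous_tsum ?_ summable_bound ?_)
  · intro n
    unfold pterm
    have h1 : Continuous fun y => squash (a y n) :=
      squash_continuous.comp ((continuous_apply n).comp ha)
    have h2 : Continuous fun y => ramp n (t y) := (ramp_continuous n).comp ht
    fun_prop
  · intro n y
    rw [Real.norm_of_nonneg (pterm_nonneg _ _ _)]
    exact pterm_le _ _ (ht1 y) n

lemma path_sep (a b : ℕ → ℝ) (h : ∀ t ∈ Set.Icc (0 : ℝ) 1, path a t = path b t) : a = b := by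
  funext n
  induction n using Nat.strong_induction_on with
  | _ n ih =>
    have h1 := h (knot (n + 1)) ⟨knot_nonneg _, knot_le_one _⟩
    unfold path at h1
    have h2 : ∑' m, (pterm a (knot (n + 1)) m - pterm b (knot (n + 1)) m) = 0 := by
      rw [Summable.tsum_sub (pterm_summable _ _ (knot_le_one _))
        (pterm_summable _ _ (knot_le_one _))]
      linarith
    rw [tsum_eq_single n] at h2
    · have h3 : 0 < ramp n (knot (n + 1)) :=
        lt_max_of_lt_right (sub_pos.2 (knot_strictMono (Nat.lt_succ_self n)))
      have h4 : (0 : ℝ) < (1 / 2) ^ n := by positivity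
      have h5 : (1 / 2 : ℝ) ^ n * ramp n (knot (n + 1)) * (squash (a n) - squash (b n)) = 0 := by
        unfold pterm at h2
        linarith
      have h6 := (mul_eq_zero.1 h5).resolve_left (mul_pos h4 h3).ne'
      exact squash_injective (sub_eq_zero.1 h6)
    · intro m hm
      rcases lt_or_gt_of_ne hm with hm | hm
      · unfold pterm
        rw [ih m hm, sub_self]
      · have : ramp m (knot (n + 1)) = 0 :=
          max_eq_left (sub_nonpos.2 (knot_strictMono.monotone hm))
        simp [pterm, this]

end

/-- `C_p(X)` has a point-separating subset homeomorphic to `[0,1]` iff `X` admits a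
continuous injection into `ℝ^ω`. -/
theorem stmt18 {X : Type u} [TopologicalSpace X] [T35Space X] [Infinite X] :
    (∃ F : Set (Cp X), PointSep1 F ∧ Nonempty (↥F ≃ₜ ↥(Set.Icc (0:ℝ) 1))) ↔
      ∃ h : X → (ℕ → ℝ), Continuous h ∧ Function.Injective h := by
  constructor
  · rintro ⟨F, hF, ⟨e⟩⟩
    haveI : Nonempty ↥(Set.Icc (0:ℝ) 1) := ⟨⟨0, by simp⟩⟩
    let d : ℕ → F := fun n => e.symm (TopologicalSpace.denseSeq ↥(Set.Icc (0:ℝ) 1) n)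
    have hd : DenseRange d :=
      e.symm.surjective.denseRange.comp (TopologicalSpace.denseRange_denseSeq _)
        e.symm.continuous
    refine ⟨fun x n => (d n).1.1 x, continuous_pi fun n => (d n).1.2, ?_⟩
    intro x y hxy
    by_contra hne
    obtain ⟨f, hf, hfne⟩ := hF x y hne
    have hev : ∀ z : X, Continuous (fun g : F => g.1.1 z) := fun z =>
      (continuous_apply z).comp (continuous_subtype_val.comp continuous_subtype_val)
    have := hd.equalizer (hev x) (hev y) (funext fun n => congrFun hxy n)
    exact hfne (congrFun this ⟨f, hf⟩)
  · rintro ⟨h, hc, hi⟩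
    let G : ↥(Set.Icc (0:ℝ) 1) → Cp X := fun t =>
      ⟨fun x => path (h x) t.1, path_continuous h (fun _ => t.1) hc continuous_const
        (fun _ => t.2.2)⟩
    have hG : Continuous G := by
      refine Continuous.subtype_mk (continuous_pi fun x => ?_) _
      exact path_continuous (fun _ => h x) (fun t : ↥(Set.Icc (0:ℝ) 1) => t.1) continuous_const
        continuous_subtype_val (fun t => t.2.2)
    have hinj : Function.Injective G := by
      obtain ⟨x⟩ : Nonempty X := inferInstance
      have hm : StrictMono (fun t : ↥(Set.Icc (0:ℝ) 1) => path (h x) t.1) :=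
        fun s t hst => path_strictMono (h x) hst t.2.2
      intro s t hst
      exact hm.injective (congrFun (congrArg Subtype.val hst) x)
    haveI : T2Space (Cp X) := inferInstanceAs (T2Space {f : X → ℝ // Continuous f})
    refine ⟨Set.range G, ?_, ⟨((hG.isClosedEmbedding hinj).isEmbedding.toHomeomorph).symm⟩⟩
    intro x y hxy
    by_contra hcon
    push Not at hcon
    exact hxy (hi (path_sep _ _ fun t ht => hcon (G ⟨t, ht⟩) ⟨_, rfl⟩))
end

section
/- Let X be an infinite separable metric space. Then C_p(X) has a topology-generating subspace homeomorphic to the closed unit interval [0,1]; that is, there is a subset F ⊆ C_p(X), homeomorphic to [0,1] in its subspace topology, such that the initial (weak) topology on X induced by the family of functions F coincides with the topology of X. -/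
open Cardinal Set

universe u

open Topology in
lemma aux_coeff (c : ℕ → ℝ) (hc : Summable fun n => |c n|)
    (h : ∀ t ∈ Set.Icc (0:ℝ) 1, ∑' n, c n * t ^ n = 0) : ∀ n, c n = 0 := by
  intro n
  induction n using Nat.strong_induction_on with
  | _ n ih =>
  have key : ∀ t ∈ Set.Ioc (0:ℝ) 1, |c n| ≤ t * ∑' k, |c k| := by
    intro t ht
    have ht0 := ht.1
    have hb : ∀ k, |c k * t ^ k| ≤ |c k| := fun k => by
      rw [abs_mul, abs_of_nonneg (pow_nonneg ht0.le k)]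
      exact mul_le_of_le_one_right (abs_nonneg _) (pow_le_one₀ ht0.le ht.2)
    have hs : Summable fun k => c k * t ^ k :=
      Summable.of_abs (Summable.of_nonneg_of_le (fun _ => abs_nonneg _) hb hc)
    have h0 := h t ⟨ht0.le, ht.2⟩
    rw [← hs.sum_add_tsum_nat_add (n+1), Finset.sum_range_succ,
      Finset.sum_eq_zero (fun k hk => by rw [ih k (Finset.mem_range.1 hk), zero_mul]), zero_add] at h0
    have hcs : Summable fun k => |c (k + (n+1))| :=
      (summable_nat_add_iff (f := fun k => |c k|) (n+1)).2 hc
    have hle : |∑' k, c (k + (n+1)) * t ^ (k + (n+1))| ≤ (∑' k, |c (k+(n+1))|) * t^(n+1) := by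
      rw [← Real.norm_eq_abs]
      refine tsum_of_norm_bounded (hcs.hasSum.mul_right (t^(n+1))) fun k => ?_
      rw [Real.norm_eq_abs, abs_mul, abs_of_nonneg (pow_nonneg ht0.le _), pow_add]
      refine mul_le_mul_of_nonneg_left ?_ (abs_nonneg _)
      exact mul_le_of_le_one_left (pow_nonneg ht0.le _) (pow_le_one₀ ht0.le ht.2)
    have hM : ∑' k, |c (k+(n+1))| ≤ ∑' k, |c k| := by
      rw [← hc.sum_add_tsum_nat_add (n+1)]
      exact le_add_of_nonneg_left (Finset.sum_nonneg fun _ _ => abs_nonneg _)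
    have h1 : |c n| * t^n ≤ (t * ∑' k, |c k|) * t^n := by
      calc |c n| * t^n = |c n * t^n| := by rw [abs_mul, abs_of_nonneg (pow_nonneg ht0.le _)]
        _ = |∑' k, c (k + (n+1)) * t ^ (k + (n+1))| := by
          rw [eq_neg_of_add_eq_zero_left h0, abs_neg]
        _ ≤ _ := hle
        _ ≤ (∑' k, |c k|) * t^(n+1) := mul_le_mul_of_nonneg_right hM (pow_nonneg ht0.le _)
        _ = _ := by ring
    exact le_of_mul_le_mul_right h1 (pow_pos ht0 n)
  by_contra hne
  have hpos := abs_pos.2 hne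
  set M := ∑' k, |c k| with hMdef
  have hM0 : 0 ≤ M := tsum_nonneg fun _ => abs_nonneg _
  have hle : |c n| ≤ M := by simpa using key 1 ⟨one_pos, le_rfl⟩
  have hMp : 0 < M := hpos.trans_le hle
  have := key (|c n| / (2*M)) ⟨by positivity, by rw [div_le_one (by positivity)]; linarith⟩
  have e : |c n| / (2*M) * M = |c n| / 2 := by field_simp
  rw [e] at this
  linarith

noncomputable def auxPhi (a : ℕ → Set.Icc (0:ℝ) 1) (t : Set.Icc (0:ℝ) 1) : ℝ :=
  ∑' n, (a n : ℝ) * (1/2)^n * (t:ℝ)^n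

lemma auxPhi_bound (a : ℕ → Set.Icc (0:ℝ) 1) (t : Set.Icc (0:ℝ) 1) (n : ℕ) :
    ‖(a n : ℝ) * (1/2)^n * (t:ℝ)^n‖ ≤ (1/2)^n := by
  have h1 := (a n).2
  have h2 := t.2
  have h3 : (t:ℝ)^n ≤ 1 := pow_le_one₀ h2.1 h2.2
  have h4 : 0 ≤ (t:ℝ)^n := pow_nonneg h2.1 n
  have h5 : (0:ℝ) < (1/2)^n := by positivity
  rw [Real.norm_of_nonneg (mul_nonneg (mul_nonneg h1.1 h5.le) h4)]
  calc _ ≤ (1 * (1/2)^n) * (1:ℝ) := mul_le_mul (mul_le_mul_of_nonneg_right h1.2 h5.le) h3 h4 (by positivity)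
    _ = _ := by ring

lemma auxPhi_cont : Continuous fun p : (ℕ → Set.Icc (0:ℝ) 1) × Set.Icc (0:ℝ) 1 =>
    auxPhi p.1 p.2 :=
  continuous_tsum (fun n => by fun_prop) summable_geometric_two (fun n p => auxPhi_bound _ _ n)

lemma auxPhi_summable (a : ℕ → Set.Icc (0:ℝ) 1) (t : Set.Icc (0:ℝ) 1) :
    Summable fun n => (a n : ℝ) * (1/2)^n * (t:ℝ)^n :=
  Summable.of_norm_bounded summable_geometric_two (auxPhi_bound a t)

lemma auxPhi_inj : Function.Injective auxPhi := by
  intro a b hab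
  have h1 := fun a => auxPhi_summable a ⟨1, by simp⟩
  simp only [one_pow, mul_one] at h1
  have := aux_coeff (fun n => (a n : ℝ) * (1/2)^n - (b n : ℝ) * (1/2)^n)
    ((h1 a).sub (h1 b)).abs (fun t ht => by
      have := congrFun hab ⟨t, ht⟩
      simp only [sub_mul]
      rw [(auxPhi_summable a ⟨t, ht⟩).tsum_sub (auxPhi_summable b ⟨t, ht⟩)]
      exact sub_eq_zero.2 this)
  funext n
  have h := this n
  rw [← sub_mul] at h
  rcases mul_eq_zero.1 h with h | h
  · exact Subtype.ext (sub_eq_zero.1 h)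
  · exact absurd h (by positivity)

lemma auxPhi_emb : Topology.IsClosedEmbedding auxPhi :=
  Continuous.isClosedEmbedding
    (continuous_pi fun t => auxPhi_cont.comp (Continuous.prodMk_left t)) auxPhi_inj

lemma auxPhi_strict (a : ℕ → Set.Icc (0:ℝ) 1) (ha : 0 < (a 1 : ℝ)) : StrictMono (auxPhi a) := by
  intro s t hst
  have hst' : (s:ℝ) < t := hst
  refine Summable.tsum_lt_tsum (i := 1) (fun n => ?_) ?_ (auxPhi_summable a s) (auxPhi_summable a t)
  · exact mul_le_mul_of_nonneg_left (pow_le_pow_left₀ s.2.1 hst'.le n)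
      (mul_nonneg (a n).2.1 (by positivity))
  · simp only [pow_one]
    exact mul_lt_mul_of_pos_left hst' (by positivity)

noncomputable def auxG {X : Type u} [MetricSpace X] (d : ℕ → X) (x : X) (n : ℕ) : Set.Icc (0:ℝ) 1 :=
  ⟨min 1 (dist x (d n)), le_min zero_le_one dist_nonneg, min_le_left _ _⟩

lemma auxG_cont {X : Type u} [MetricSpace X] (d : ℕ → X) : Continuous (auxG d) := by
  refine continuous_pi fun n => ?_
  exact Continuous.subtype_mk (by fun_prop) _

open Topology in
lemma auxG_ind {X : Type u} [MetricSpace X] (d : ℕ → X) (hd : DenseRange d) :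
    IsInducing (auxG d) := by
  rw [isInducing_iff_nhds]
  intro x
  refine le_antisymm ((auxG_cont d).tendsto x).le_comap ?_
  refine Metric.nhds_basis_ball.ge_iff.2 fun ε hε => ?_
  obtain ⟨n, hn⟩ := hd.exists_dist_lt x (ε := min 1 (ε/2)) (by positivity)
  have hn1 : dist x (d n) < 1 := hn.trans_le (min_le_left _ _)
  have hn2 : dist x (d n) < ε/2 := hn.trans_le (min_le_right _ _)
  refine Filter.mem_comap.2 ⟨{a | (a n : ℝ) < min 1 (ε/2)}, ?_, ?_⟩
  · refine (isOpen_lt (by fun_prop) continuous_const).mem_nhds ?_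
    exact (min_le_right _ _).trans_lt hn
  · intro y hy
    have hy' : min 1 (dist y (d n)) < min 1 (ε/2) := hy
    have hy2 : dist y (d n) < ε/2 := by
      rcases min_lt_iff.1 hy' with h | h
      · exact absurd (h.trans_le (min_le_left _ _)) (lt_irrefl _)
      · exact h.trans_le (min_le_right _ _)
    rw [Metric.mem_ball]
    have := dist_triangle_right y x (d n)
    linarith

/-- Every infinite separable metric space `X` admits a topology-generating subspace of
`C_p(X)` homeomorphic to `[0,1]`: the initial topology induced by the family `F` equals
the topology of `X`. -/
theorem stmt19 {X : Type u} [MetricSpace X] [TopologicalSpace.SeparableSpace X]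
    [Infinite X] :
    ∃ F : Set (Cp X), Nonempty (↥F ≃ₜ ↥(Set.Icc (0:ℝ) 1)) ∧
      (⨅ f : F, TopologicalSpace.induced (fun x => (f : Cp X).1 x)
        (inferInstance : TopologicalSpace ℝ)) = (inferInstance : TopologicalSpace X) := by
  classical
  let d := TopologicalSpace.denseSeq X
  have hd : DenseRange d := TopologicalSpace.denseRange_denseSeq X
  have hcont : Continuous fun p : X × Set.Icc (0:ℝ) 1 => auxPhi (auxG d p.1) p.2 :=
    auxPhi_cont.comp (((auxG_cont d).comp continuous_fst).prodMk continuous_snd)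
  let f : Set.Icc (0:ℝ) 1 → Cp X := fun t =>
    ⟨fun x => auxPhi (auxG d x) t, hcont.comp (Continuous.prodMk_left t)⟩
  have hf : Continuous f :=
    Continuous.subtype_mk (continuous_pi fun x => hcont.comp (Continuous.prodMk_right x)) _
  have : T2Space (Cp X) := inferInstanceAs (T2Space {f : X → ℝ // Continuous f})
  have hinj : Function.Injective f := by
    intro s t hst
    obtain ⟨x, hx⟩ := exists_ne (d 1)
    have h1 : auxPhi (auxG d x) s = auxPhi (auxG d x) t := congrFun (congrArg Subtype.val hst) x
    exact (auxPhi_strict (auxG d x) (lt_min one_pos (dist_pos.2 hx))).injective h1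
  refine ⟨Set.range f, ⟨(hf.isClosedEmbedding hinj).isEmbedding.toHomeomorph.symm⟩, ?_⟩
  have hind := auxPhi_emb.isInducing.comp (auxG_ind d hd)
  refine Eq.trans ?_ hind.eq_induced.symm
  rw [Pi.topologicalSpace, induced_iInf]
  simp only [induced_compose]
  exact iInf_range' (fun g : Cp X => TopologicalSpace.induced (fun x => g.1 x) inferInstance) f
end
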